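/- Let A be a commutative noetherian ring, x = x_1,…,x_t ∈ A, and M an A-module with dim M ≤ 1. If the Koszul cohomology modules H^0(x,M) and H^1(x,M) are finitely generated, then H^i(x,M) is finitely generated for all i ≥ 0. -/

import Mathlib

open CategoryTheory Limits

noncomputable section

variable {A : Type} [CommRing A]

/-- The `i`-th term of the Koszul cochain complex `Hom_A(K_•(x), M)`. -/
abbrev KoszulCochain {t : ℕ} (x : Fin t → A) (M : Type) [AddCommGroup M] [Module A M]
    (i : ℕ) : Type :=
  {s : Finset (Fin t) // s.card = i} → M

/-- The Koszul cochain differential. -/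
def koszulD {t : ℕ} (x : Fin t → A) (M : Type) [AddCommGroup M] [Module A M] (i : ℕ) :
    KoszulCochain x M i →ₗ[A] KoszulCochain x M (i + 1) :=
  LinearMap.pi fun s => ∑ j ∈ s.1.attach,
    (((-1 : A) ^ ((s.1.filter (fun k => k < j.1)).card)) * x j.1) •
      (LinearMap.proj
        (⟨s.1.erase j.1, by simp [Finset.card_erase_of_mem j.2, s.2]⟩ :
          {s : Finset (Fin t) // s.card = i}) :
        KoszulCochain x M i →ₗ[A] M)

/-- The boundaries in degree `i` of the Koszul cochain complex. -/
def koszulBoundary {t : ℕ} (x : Fin t → A) (M : Type) [AddCommGroup M] [Module A M] :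
    (i : ℕ) → Submodule A (KoszulCochain x M i)
  | 0 => ⊥
  | j + 1 => LinearMap.range (koszulD x M j)

/-- The `i`-th Koszul cohomology `H^i(x, M)` of `M` with respect to `x`. -/
abbrev KoszulCohomology {t : ℕ} (x : Fin t → A) (M : Type) [AddCommGroup M] [Module A M]
    (i : ℕ) : Type :=
  LinearMap.ker (koszulD x M i) ⧸
    (koszulBoundary x M i).comap (LinearMap.ker (koszulD x M i)).subtype

/-- Sign attached to `j` relative to `s`. -/
def ksgn (A : Type) [CommRing A] {t : ℕ} (s : Finset (Fin t)) (j : Fin t) : A :=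
  (-1 : A) ^ ((s.filter (fun k => k < j)).card)

lemma ksgn_sq {t : ℕ} (s : Finset (Fin t)) (j : Fin t) : ksgn A s j * ksgn A s j = 1 := by
  unfold ksgn
  rw [← pow_add, ← two_mul, pow_mul]
  simp

lemma ksgn_erase_of_le {t : ℕ} (s : Finset (Fin t)) (j k : Fin t) (h : k ≤ j) :
    ksgn A (s.erase j) k = ksgn A s k := by
  unfold ksgn
  congr 2
  ext a
  simp only [Finset.mem_filter, Finset.mem_erase]
  constructor
  · rintro ⟨⟨_, h1⟩, h2⟩
    exact ⟨h1, h2⟩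
  · rintro ⟨h1, h2⟩
    exact ⟨⟨(lt_of_lt_of_le h2 h).ne, h1⟩, h2⟩

lemma ksgn_erase_of_lt {t : ℕ} (s : Finset (Fin t)) (j k : Fin t) (hj : j ∈ s) (h : j < k) :
    ksgn A s k = - ksgn A (s.erase j) k := by
  unfold ksgn
  have : s.filter (fun l => l < k) = insert j ((s.erase j).filter (fun l => l < k)) := by
    ext a
    simp only [Finset.mem_filter, Finset.mem_erase, Finset.mem_insert]
    by_cases ha : a = j
    · subst ha; simp [hj, h]
    · simp [ha]
  rw [this, Finset.card_insert_of_notMem (by simp), pow_succ]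
  ring

lemma ksgn_swap {t : ℕ} (s : Finset (Fin t)) (j k : Fin t) (hj : j ∈ s) (hk : k ∈ s)
    (h : j ≠ k) :
    ksgn A s j * ksgn A (s.erase j) k + ksgn A s k * ksgn A (s.erase k) j = 0 := by
  rcases lt_or_gt_of_ne h with h | h
  · rw [ksgn_erase_of_le s k j h.le, ksgn_erase_of_lt s j k hj h]; ring
  · rw [ksgn_erase_of_le s j k h.le, ksgn_erase_of_lt s k j hk h]; ring

/-- Total differential on all functions `Finset (Fin t) → M`. -/
def kD {t : ℕ} (x : Fin t → A) {M : Type} [AddCommGroup M] [Module A M]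
    (c : Finset (Fin t) → M) (s : Finset (Fin t)) : M :=
  ∑ j ∈ s, (ksgn A s j * x j) • c (s.erase j)

/-- Total homotopy. -/
def kH (A : Type) [CommRing A] {t : ℕ} (j : Fin t) {M : Type} [AddCommGroup M] [Module A M]
    (c : Finset (Fin t) → M) (s : Finset (Fin t)) : M :=
  if j ∈ s then 0 else ksgn A s j • c (insert j s)

lemma kD_kD {t : ℕ} (x : Fin t → A) {M : Type} [AddCommGroup M] [Module A M]
    (c : Finset (Fin t) → M) (s : Finset (Fin t)) : kD x (kD x c) s = 0 := by
  unfold kD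
  simp only [Finset.smul_sum, smul_smul]
  rw [Finset.sum_sigma']
  refine Finset.sum_involution (fun a _ => ⟨a.2, a.1⟩) ?_ ?_ ?_ ?_
  · rintro ⟨j, k⟩ h
    simp only [Finset.mem_sigma, Finset.mem_erase] at h
    rw [Finset.erase_right_comm, ← add_smul]
    have := ksgn_swap (A := A) s j k h.1 h.2.2 (Ne.symm h.2.1)
    have h2 : ksgn A s j * x j * (ksgn A (s.erase j) k * x k) +
      ksgn A s k * x k * (ksgn A (s.erase k) j * x j) = 0 := by
      linear_combination (x j * x k) * this
    rw [h2, zero_smul]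
  · rintro ⟨j, k⟩ h _ he
    simp only [Finset.mem_sigma, Finset.mem_erase] at h
    simp only [Sigma.mk.injEq] at he
    exact h.2.1 he.1
  · rintro ⟨j, k⟩ h
    simp only [Finset.mem_sigma, Finset.mem_erase] at h ⊢
    exact ⟨h.2.2, Ne.symm h.2.1, h.1⟩
  · rintro ⟨j, k⟩ h
    rfl

lemma kD_kH {t : ℕ} (x : Fin t → A) (j : Fin t) {M : Type} [AddCommGroup M] [Module A M]
    (c : Finset (Fin t) → M) (s : Finset (Fin t)) :
    kD x (kH A j c) s + kH A j (kD x c) s = x j • c s := by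
  by_cases hj : j ∈ s
  · have h1 : kH A j (kD x c) s = 0 := by simp [kH, hj]
    rw [h1, add_zero]
    unfold kD
    rw [Finset.sum_eq_single j]
    · simp only [kH, Finset.mem_erase, ne_eq, not_true_eq_false, false_and, if_false,
        Finset.insert_erase hj, smul_smul]
      rw [ksgn_erase_of_le s j j le_rfl]
      congr 1
      linear_combination (x j) * ksgn_sq (A := A) s j
    · intro k hk hkj
      simp [kH, hj, Ne.symm hkj]
    · intro h; exact absurd hj h
  · have h1 : kH A j (kD x c) s = ksgn A s j • kD x c (insert j s) := by simp [kH, hj]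
    rw [h1]
    unfold kD
    rw [Finset.sum_insert hj, Finset.erase_insert hj, smul_add, smul_smul, Finset.smul_sum]
    have h2 : ksgn A (insert j s) j = ksgn A s j := by
      rw [← ksgn_erase_of_le (insert j s) j j le_rfl, Finset.erase_insert hj]
    rw [h2, ← mul_assoc, ksgn_sq, one_mul, add_left_comm, ← Finset.sum_add_distrib,
      Finset.sum_eq_zero, add_zero]
    intro k hk
    have hkj : k ≠ j := fun h => hj (h ▸ hk)
    have h3 : (insert j s).erase k = insert j (s.erase k) :=
      Finset.erase_insert_of_ne (Ne.symm hkj)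
    simp only [kH, Finset.mem_erase, hj, and_false, if_false, smul_smul, h3]
    rw [← add_smul]
    have h4 := ksgn_swap (A := A) (insert j s) j k (by simp) (by simp [hk]) (Ne.symm hkj)
    rw [Finset.erase_insert hj, h2] at h4
    have h5 : ksgn A (s.erase k) j * ksgn A s k = - (ksgn A s j * ksgn A (insert j s) k) := by
      rcases lt_or_gt_of_ne hkj with h | h
      · have e1 := ksgn_erase_of_lt (A := A) s k j hk h
        have e2 := ksgn_erase_of_le (A := A) (insert j s) j k h.le
        rw [Finset.erase_insert hj] at e2
        rw [e1, e2]; ring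
      · have e1 := ksgn_erase_of_le (A := A) s k j h.le
        have e2 := ksgn_erase_of_lt (A := A) (insert j s) j k (by simp) h
        rw [Finset.erase_insert hj] at e2
        rw [e1, e2]; ring
    have h6 : ksgn A s k * x k * ksgn A (s.erase k) j +
        ksgn A s j * (ksgn A (insert j s) k * x k) = 0 := by
      linear_combination (x k) * h5
    rw [h6, zero_smul]

/-- Extension by zero. -/
def kext {t : ℕ} {M : Type} [AddCommGroup M] {i : ℕ}
    (c : {s : Finset (Fin t) // s.card = i} → M) (s : Finset (Fin t)) : M :=
  if h : s.card = i then c ⟨s, h⟩ else 0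

lemma koszulD_apply {t : ℕ} (x : Fin t → A) (M : Type) [AddCommGroup M] [Module A M] (i : ℕ)
    (c : KoszulCochain x M i) (s : {s : Finset (Fin t) // s.card = i + 1}) :
    koszulD x M i c s = kD x (kext c) s.1 := by
  unfold koszulD kD
  rw [← Finset.sum_attach s.1]
  simp only [LinearMap.pi_apply, LinearMap.sum_apply, LinearMap.smul_apply, LinearMap.proj_apply]
  refine Finset.sum_congr rfl fun j _ => ?_
  have : (s.1.erase j.1).card = i := by simp [Finset.card_erase_of_mem j.2, s.2]
  simp only [kext, this, dif_pos, ksgn]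

lemma kext_koszulD {t : ℕ} (x : Fin t → A) (M : Type) [AddCommGroup M] [Module A M] (i : ℕ)
    (c : KoszulCochain x M i) : kext (koszulD x M i c) = kD x (kext c) := by
  ext s
  by_cases h : s.card = i + 1
  · rw [kext, dif_pos h, koszulD_apply]
  · rw [kext, dif_neg h]
    symm
    unfold kD
    refine Finset.sum_eq_zero fun j hj => ?_
    have : (s.erase j).card ≠ i := by
      rw [Finset.card_erase_of_mem hj]
      have := Finset.card_pos.2 ⟨j, hj⟩
      omega
    simp [kext, this]

lemma koszulD_koszulD {t : ℕ} (x : Fin t → A) (M : Type) [AddCommGroup M] [Module A M] (i : ℕ)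
    (c : KoszulCochain x M i) : koszulD x M (i + 1) (koszulD x M i c) = 0 := by
  ext s
  rw [koszulD_apply, kext_koszulD, kD_kD]
  rfl

/-- cocycles -/
abbrev kZ {t : ℕ} (x : Fin t → A) (M : Type) [AddCommGroup M] [Module A M] (i : ℕ) :
    Submodule A (KoszulCochain x M i) := LinearMap.ker (koszulD x M i)

lemma kB_le_kZ {t : ℕ} (x : Fin t → A) (M : Type) [AddCommGroup M] [Module A M] (i : ℕ) :
    koszulBoundary x M i ≤ kZ x M i := by
  cases i with
  | zero => exact bot_le
  | succ i =>
    rintro _ ⟨c, rfl⟩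
    exact koszulD_koszulD x M i c

lemma x_smul_kZ {t : ℕ} (x : Fin t → A) (j : Fin t) (M : Type) [AddCommGroup M] [Module A M]
    (i : ℕ) (z : KoszulCochain x M i) (hz : z ∈ kZ x M i) :
    x j • z ∈ koszulBoundary x M i := by
  have hz' : kD x (kext z) = 0 := by
    rw [← kext_koszulD, LinearMap.mem_ker.1 hz]
    ext s; simp [kext]
  have key : ∀ s, kD x (kH A j (kext z)) s = x j • kext z s := by
    intro s
    rw [← kD_kH x j (kext z) s, hz']
    simp [kH]
  cases i with
  | zero =>
    show x j • z = 0
    ext s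
    have := key s.1
    have hs : s.1 = ∅ := Finset.card_eq_zero.1 s.2
    have h0 : kD x (kH A j (kext z)) s.1 = 0 := by rw [hs]; simp [kD]
    rw [h0, kext, dif_pos s.2] at this
    exact this.symm
  | succ i =>
    refine ⟨fun s => kH A j (kext z) s.1, ?_⟩
    ext s
    rw [koszulD_apply]
    have h1 : kext (i := i) (fun s => kH A j (kext z) s.1) = kH A j (kext z) := by
      ext s
      by_cases h : s.card = i
      · rw [kext, dif_pos h]
      · rw [kext, dif_neg h, kH]
        split_ifs with hj
        · rfl
        · have : (insert j s).card ≠ i + 1 := by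
            rw [Finset.card_insert_of_notMem hj]; omega
          simp [kext, this]
    rw [h1, key, kext, dif_pos s.2]
    rfl

/-- functoriality on cochains -/
def kmap {t : ℕ} (x : Fin t → A) {M N : Type} [AddCommGroup M] [Module A M] [AddCommGroup N]
    [Module A N] (f : M →ₗ[A] N) (i : ℕ) : KoszulCochain x M i →ₗ[A] KoszulCochain x N i :=
  LinearMap.compLeft f _

lemma kmap_D {t : ℕ} (x : Fin t → A) {M N : Type} [AddCommGroup M] [Module A M] [AddCommGroup N]
    [Module A N] (f : M →ₗ[A] N) (i : ℕ) (c : KoszulCochain x M i) :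
    koszulD x N i (kmap x f i c) = kmap x f (i + 1) (koszulD x M i c) := by
  ext s
  simp [koszulD, kmap, LinearMap.sum_apply, map_sum]

lemma kmap_inj {t : ℕ} (x : Fin t → A) {M N : Type} [AddCommGroup M] [Module A M]
    [AddCommGroup N] [Module A N] (f : M →ₗ[A] N) (hf : Function.Injective f) (i : ℕ) :
    Function.Injective (kmap x f i) := by
  intro a b h
  ext s
  exact hf (congrFun h s)

lemma kmap_surj {t : ℕ} (x : Fin t → A) {M N : Type} [AddCommGroup M] [Module A M]
    [AddCommGroup N] [Module A N] (f : M →ₗ[A] N) (hf : Function.Surjective f) (i : ℕ) :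
    Function.Surjective (kmap x f i) := by
  intro b
  choose g hg using hf
  exact ⟨fun s => g (b s), by ext s; exact hg _⟩

lemma kmap_exact {t : ℕ} (x : Fin t → A) {M N P : Type} [AddCommGroup M] [Module A M]
    [AddCommGroup N] [Module A N] [AddCommGroup P] [Module A P] (f : M →ₗ[A] N) (g : N →ₗ[A] P)
    (h : Function.Exact f g) (i : ℕ) : Function.Exact (kmap x f i) (kmap x g i) := by
  intro c
  constructor
  · intro hc
    have : ∀ s, ∃ m, f m = c s := fun s => (h (c s)).1 (congrFun hc s)
    choose b hb using this
    exact ⟨b, by ext s; exact hb s⟩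
  · rintro ⟨b, rfl⟩
    ext s
    exact (h _).2 ⟨b s, rfl⟩

lemma kmap_B {t : ℕ} (x : Fin t → A) {M N : Type} [AddCommGroup M] [Module A M] [AddCommGroup N]
    [Module A N] (f : M →ₗ[A] N) (i : ℕ) :
    (koszulBoundary x M i).map (kmap x f i) ≤ koszulBoundary x N i := by
  cases i with
  | zero => simp [koszulBoundary]
  | succ i =>
    rintro _ ⟨_, ⟨c, rfl⟩, rfl⟩
    exact ⟨kmap x f i c, kmap_D x f i c⟩

lemma kmap_Z {t : ℕ} (x : Fin t → A) {M N : Type} [AddCommGroup M] [Module A M] [AddCommGroup N]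
    [Module A N] (f : M →ₗ[A] N) (i : ℕ) (z : KoszulCochain x M i) (hz : z ∈ kZ x M i) :
    kmap x f i z ∈ kZ x N i := by
  rw [LinearMap.mem_ker, kmap_D, LinearMap.mem_ker.1 hz, map_zero]

/-- `W` is finitely generated modulo `B`. -/
def RelFG {X : Type} [AddCommGroup X] [Module A X] (B W : Submodule A X) : Prop :=
  ∃ F : Submodule A X, F.FG ∧ W ≤ B ⊔ F

lemma RelFG.mono {X : Type} [AddCommGroup X] [Module A X] {B B' W W' : Submodule A X}
    (h : RelFG B W) (hB : B ≤ B') (hW : W' ≤ W) : RelFG B' W' := by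
  obtain ⟨F, hF, h⟩ := h
  exact ⟨F, hF, hW.trans (h.trans (sup_le_sup_right hB F))⟩

lemma RelFG.of_le {X : Type} [AddCommGroup X] [Module A X] {B W : Submodule A X}
    (h : W ≤ B) : RelFG B W := ⟨⊥, Submodule.fg_bot, by simpa using h⟩

lemma RelFG.sup {X : Type} [AddCommGroup X] [Module A X] {B W W' : Submodule A X}
    (h : RelFG B W) (h' : RelFG B W') : RelFG B (W ⊔ W') := by
  obtain ⟨F, hF, h⟩ := h
  obtain ⟨F', hF', h'⟩ := h'
  refine ⟨F ⊔ F', hF.sup hF', sup_le ?_ ?_⟩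
  · exact h.trans (sup_le_sup_left le_sup_left _)
  · exact h'.trans (sup_le_sup_left le_sup_right _)

lemma RelFG.map {X Y : Type} [AddCommGroup X] [Module A X] [AddCommGroup Y] [Module A Y]
    {B W : Submodule A X} (h : RelFG B W) (g : X →ₗ[A] Y) : RelFG (B.map g) (W.map g) := by
  obtain ⟨F, hF, h⟩ := h
  exact ⟨F.map g, hF.map g, by rw [← Submodule.map_sup]; exact Submodule.map_mono h⟩

lemma RelFG.devissage [IsNoetherianRing A] {X Y : Type} [AddCommGroup X] [Module A X]
    [AddCommGroup Y] [Module A Y] (g : X →ₗ[A] Y) {B W : Submodule A X} {C : Submodule A Y}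
    (h1 : RelFG C (W.map g)) (h2 : RelFG B (W ⊓ C.comap g)) : RelFG B W := by
  obtain ⟨F, hF, h1⟩ := h1
  obtain ⟨G, hG, h2⟩ := h2
  -- the image of `W` in `Y ⧸ C` is finitely generated
  let φ : X →ₗ[A] (Y ⧸ C) := C.mkQ ∘ₗ g
  have hle : W.map φ ≤ F.map C.mkQ := by
    rw [Submodule.map_comp]
    refine (Submodule.map_mono h1).trans ?_
    rw [Submodule.map_sup]
    simp
  have hFn : IsNoetherian A (F.map C.mkQ) := isNoetherian_of_fg_of_noetherian _ (hF.map _)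
  have hfg : (W.map φ).FG := by
    have := isNoetherian_of_le hle
    exact Submodule.FG.of_finite
  obtain ⟨G', hG'W, hG', hG'e⟩ : ∃ G' : Submodule A X, G' ≤ W ∧ G'.FG ∧ G'.map φ = W.map φ := by
    obtain ⟨S, hS⟩ := hfg
    have hmem : ∀ s : S, ∃ w ∈ W, φ w = s := by
      intro s
      have : (s : Y ⧸ C) ∈ W.map φ := by rw [← hS]; exact Submodule.subset_span s.2
      simpa using this
    choose w hwW hw using hmem
    refine ⟨Submodule.span A (Set.range w), ?_, ?_, ?_⟩
    · rw [Submodule.span_le]; rintro _ ⟨s, rfl⟩; exact hwW s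
    · exact Submodule.fg_span (Set.finite_range w)
    · rw [← hS, Submodule.map_span]
      congr 1
      ext y
      constructor
      · rintro ⟨_, ⟨s, rfl⟩, rfl⟩; rw [hw]; exact s.2
      · intro hy; exact ⟨w ⟨y, hy⟩, ⟨_, rfl⟩, hw _⟩
  refine ⟨G ⊔ G', hG.sup hG', ?_⟩
  intro w hw
  have : φ w ∈ G'.map φ := by rw [hG'e]; exact ⟨w, hw, rfl⟩
  obtain ⟨g', hgg, he⟩ := this
  have h3 : w - g' ∈ W ⊓ C.comap g := by
    refine ⟨W.sub_mem hw (hG'W hgg), ?_⟩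
    have : φ (w - g') = 0 := by rw [map_sub, he, sub_self]
    exact (Submodule.Quotient.mk_eq_zero C).1 this
  have h4 := h2 h3
  have h5 : w = (w - g') + g' := by abel
  rw [h5, ← sup_assoc]
  exact Submodule.add_mem_sup h4 hgg

/-- `H^i(x,M)` is finitely generated, relative form. -/
def KFin {t : ℕ} (x : Fin t → A) (M : Type) [AddCommGroup M] [Module A M] (i : ℕ) : Prop :=
  RelFG (koszulBoundary x M i) (kZ x M i)

lemma kfin_iff [IsNoetherianRing A] {t : ℕ} (x : Fin t → A) (M : Type) [AddCommGroup M]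
    [Module A M] (i : ℕ) : Module.Finite A (KoszulCohomology x M i) ↔ KFin x M i := by
  constructor
  · intro h
    obtain ⟨S, hS⟩ := h.fg_top
    have hsurj : ∀ s : KoszulCohomology x M i, ∃ z : LinearMap.ker (koszulD x M i),
      Submodule.Quotient.mk z = s := fun s => Submodule.Quotient.mk_surjective _ s
    choose z hz using hsurj
    refine ⟨(Submodule.span A (z '' S)).map (LinearMap.ker (koszulD x M i)).subtype,
      (Submodule.fg_span (S.finite_toSet.image z)).map _, ?_⟩
    intro w hw
    have h1 : (Submodule.span A (z '' S)).map (Submodule.mkQ ((koszulBoundary x M i).comap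
        (LinearMap.ker (koszulD x M i)).subtype)) = ⊤ := by
      rw [Submodule.map_span, ← hS, Set.image_image]
      congr 1
      ext y
      simp [hz]
    have h2 : Submodule.mkQ ((koszulBoundary x M i).comap
        (LinearMap.ker (koszulD x M i)).subtype) ⟨w, hw⟩ ∈ (⊤ : Submodule A _) := trivial
    rw [← h1] at h2
    obtain ⟨v, hv, he⟩ := h2
    rw [eq_comm, ← sub_eq_zero, ← map_sub] at he
    rw [Submodule.mkQ_apply, Submodule.Quotient.mk_eq_zero] at he
    have h5 : w = (w - v.1) + v.1 := by abel
    rw [h5]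
    exact Submodule.add_mem_sup he ⟨v, hv, rfl⟩
  · rintro ⟨F, hF, h⟩
    have hFn : IsNoetherian A (F.map (koszulBoundary x M i).mkQ) :=
      isNoetherian_of_fg_of_noetherian _ (hF.map _)
    let φ : KoszulCohomology x M i →ₗ[A] (KoszulCochain x M i ⧸ koszulBoundary x M i) :=
      Submodule.mapQ _ _ (LinearMap.ker (koszulD x M i)).subtype le_rfl
    have hφ : Function.Injective φ := by
      rw [← LinearMap.ker_eq_bot, Submodule.ker_mapQ]
      exact Submodule.mkQ_map_self _
    have hr : ∀ c, φ c ∈ F.map (koszulBoundary x M i).mkQ := by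
      intro c
      obtain ⟨z, rfl⟩ := Submodule.Quotient.mk_surjective _ c
      obtain ⟨b, hb, f, hf, he⟩ := Submodule.mem_sup.1 (h z.2)
      refine ⟨f, hf, ?_⟩
      show _ = Submodule.Quotient.mk z.1
      rw [Submodule.mkQ_apply, Submodule.Quotient.eq, ← he]
      simpa using hb
    exact Module.Finite.of_injective (φ.codRestrict _ hr)
      (fun a b hab => hφ (by simpa using congrArg Subtype.val hab))

section les

variable {t : ℕ} (x : Fin t → A) {M' M M'' : Type} [AddCommGroup M'] [Module A M']
  [AddCommGroup M] [Module A M] [AddCommGroup M''] [Module A M'']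

lemma kB_lift (g : M →ₗ[A] M'') (hg : Function.Surjective g) (i : ℕ) (z : KoszulCochain x M i)
    (hzB : kmap x g i z ∈ koszulBoundary x M'' i) :
    ∃ b ∈ koszulBoundary x M i, kmap x g i b = kmap x g i z := by
  cases i with
  | zero =>
    refine ⟨0, Submodule.zero_mem _, ?_⟩
    have : kmap x g 0 z = 0 := hzB
    rw [this, map_zero]
  | succ i =>
    obtain ⟨c, hc⟩ := hzB
    obtain ⟨c', rfl⟩ := kmap_surj x g hg i c
    exact ⟨koszulD x M i c', ⟨c', rfl⟩, by rw [← kmap_D, hc]⟩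

lemma les_a' [IsNoetherianRing A] (f : M' →ₗ[A] M) (g : M →ₗ[A] M'')
    (hf : Function.Injective f) (hg : Function.Surjective g) (hfg : Function.Exact f g) (i : ℕ)
    (h' : KFin x M' i) (W : Submodule A (KoszulCochain x M i)) (hW : W ≤ kZ x M i)
    (h'' : RelFG (koszulBoundary x M'' i) (W.map (kmap x g i))) :
    RelFG (koszulBoundary x M i) W := by
  refine RelFG.devissage (kmap x g i) h'' ?_
  have h3 : RelFG (koszulBoundary x M i)
      (koszulBoundary x M i ⊔ (kZ x M' i).map (kmap x f i)) := by
    refine RelFG.sup (RelFG.of_le le_rfl) ?_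
    exact RelFG.mono (RelFG.map h' (kmap x f i)) (kmap_B x f i) le_rfl
  refine h3.mono le_rfl ?_
  rintro z ⟨hzW, hzB⟩
  have hz := hW hzW
  obtain ⟨b, hb, hbe⟩ := kB_lift x g hg i z hzB
  obtain ⟨w, hw⟩ := (kmap_exact x f g hfg i (z - b)).1 (by rw [map_sub, hbe, sub_self])
  have h5 : z = b + (z - b) := by abel
  rw [h5, ← hw]
  refine Submodule.add_mem_sup hb ⟨w, ?_, rfl⟩
  apply kmap_inj x f hf (i + 1)
  rw [← kmap_D, hw, map_zero, map_sub, LinearMap.mem_ker.1 hz,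
    LinearMap.mem_ker.1 (kB_le_kZ x M i hb), sub_zero]

lemma les_a [IsNoetherianRing A] (f : M' →ₗ[A] M) (g : M →ₗ[A] M'')
    (hf : Function.Injective f) (hg : Function.Surjective g) (hfg : Function.Exact f g) (i : ℕ)
    (h' : KFin x M' i) (h'' : KFin x M'' i) : KFin x M i := by
  refine les_a' x f g hf hg hfg i h' _ le_rfl (h''.mono le_rfl ?_)
  rintro _ ⟨z, hz, rfl⟩
  exact kmap_Z x g i z hz

lemma les_b [IsNoetherianRing A] (f : M' →ₗ[A] M) (g : M →ₗ[A] M'')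
    (hf : Function.Injective f) (hg : Function.Surjective g) (hfg : Function.Exact f g) (i : ℕ)
    (h : KFin x M i) (h' : KFin x M' (i + 1)) : KFin x M'' i := by
  have key : RelFG (koszulBoundary x M i ⊔ LinearMap.range (kmap x f i))
      ((kZ x M'' i).comap (kmap x g i)) := by
    refine RelFG.devissage (koszulD x M i)
      (C := (koszulBoundary x M' (i + 1)).map (kmap x f (i + 1))) ?_ ?_
    · refine (h'.map (kmap x f (i + 1))).mono le_rfl ?_
      rintro _ ⟨w, hw, rfl⟩
      have h1 : kmap x g (i + 1) (koszulD x M i w) = 0 := by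
        rw [← kmap_D]; exact hw
      obtain ⟨v, hv⟩ := (kmap_exact x f g hfg (i + 1) _).1 h1
      refine ⟨v, ?_, hv⟩
      apply kmap_inj x f hf (i + 2)
      rw [← kmap_D, hv, koszulD_koszulD, map_zero]
    · have h3 : RelFG (koszulBoundary x M i ⊔ LinearMap.range (kmap x f i))
          (kZ x M i ⊔ LinearMap.range (kmap x f i)) :=
        RelFG.sup (h.mono le_sup_left le_rfl) (RelFG.of_le le_sup_right)
      refine h3.mono le_rfl ?_
      rintro z ⟨-, hz⟩
      obtain ⟨_, ⟨b, rfl⟩, hb⟩ := hz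
      have h5 : z = (z - kmap x f i b) + kmap x f i b := by abel
      rw [h5]
      refine Submodule.add_mem_sup ?_ ⟨b, rfl⟩
      rw [LinearMap.mem_ker, map_sub, kmap_D, hb, sub_self]
  refine (key.map (kmap x g i)).mono ?_ ?_
  · rw [Submodule.map_sup]
    refine sup_le (kmap_B x g i) ?_
    rintro _ ⟨_, ⟨c, rfl⟩, rfl⟩
    rw [(kmap_exact x f g hfg i _).2 ⟨c, rfl⟩]
    exact Submodule.zero_mem _
  · intro z hz
    obtain ⟨c, rfl⟩ := kmap_surj x g hg i z
    exact ⟨c, hz, rfl⟩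

lemma les_c' [IsNoetherianRing A] (f : M' →ₗ[A] M) (g : M →ₗ[A] M'')
    (hf : Function.Injective f) (hg : Function.Surjective g) (hfg : Function.Exact f g) (i : ℕ)
    (h'' : KFin x M'' i) :
    RelFG (koszulBoundary x M' (i + 1))
      (kZ x M' (i + 1) ⊓ (koszulBoundary x M (i + 1)).comap (kmap x f (i + 1))) := by
  have key : RelFG (koszulBoundary x M i ⊔ LinearMap.range (kmap x f i))
      ((kZ x M'' i).comap (kmap x g i)) := by
    refine RelFG.devissage (kmap x g i) (C := koszulBoundary x M'' i)
      (h''.mono le_rfl (Submodule.map_comap_le _ _)) ?_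
    refine RelFG.of_le ?_
    rintro z ⟨-, hz⟩
    obtain ⟨b, hb, hbe⟩ := kB_lift x g hg i z hz
    obtain ⟨w, hw⟩ := (kmap_exact x f g hfg i (z - b)).1 (by rw [map_sub, hbe, sub_self])
    have h5 : z = b + (z - b) := by abel
    rw [h5]
    exact Submodule.add_mem_sup hb ⟨w, hw⟩
  refine RelFG.devissage (kmap x f (i + 1))
    (C := (koszulBoundary x M' (i + 1)).map (kmap x f (i + 1))) ?_ ?_
  · refine (key.map (koszulD x M i)).mono ?_ ?_
    · rw [Submodule.map_sup]
      refine sup_le ?_ ?_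
      · rintro _ ⟨b, hb, rfl⟩
        rw [LinearMap.mem_ker.1 (kB_le_kZ x M i hb)]
        exact Submodule.zero_mem _
      · rintro _ ⟨_, ⟨c, rfl⟩, rfl⟩
        exact ⟨koszulD x M' i c, ⟨c, rfl⟩, (kmap_D x f i c).symm⟩
    · rintro _ ⟨w, ⟨hw, ⟨b, hb⟩⟩, rfl⟩
      refine ⟨b, ?_, hb⟩
      show _ = 0
      rw [kmap_D, hb]
      exact (kmap_exact x f g hfg (i + 1) _).2 ⟨w, rfl⟩
  · refine RelFG.of_le ?_
    rintro w ⟨-, ⟨b, hb, he⟩⟩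
    rwa [← kmap_inj x f hf (i + 1) he]

lemma les_c [IsNoetherianRing A] (f : M' →ₗ[A] M) (g : M →ₗ[A] M'')
    (hf : Function.Injective f) (hg : Function.Surjective g) (hfg : Function.Exact f g) (i : ℕ)
    (h'' : KFin x M'' i) (h : KFin x M (i + 1)) : KFin x M' (i + 1) := by
  refine RelFG.devissage (kmap x f (i + 1)) (C := koszulBoundary x M (i + 1)) ?_
    (les_c' x f g hf hg hfg i h'')
  refine h.mono le_rfl ?_
  rintro _ ⟨z, hz, rfl⟩
  exact kmap_Z x f _ z hz

lemma les_c0 [IsNoetherianRing A] (f : M' →ₗ[A] M)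
    (hf : Function.Injective f) (h : KFin x M 0) : KFin x M' 0 := by
  refine RelFG.devissage (kmap x f 0) (C := koszulBoundary x M 0) (h.mono le_rfl ?_) ?_
  · rintro _ ⟨z, hz, rfl⟩
    exact kmap_Z x f _ z hz
  · refine RelFG.of_le ?_
    rintro z ⟨-, hz⟩
    have : kmap x f 0 z = 0 := hz
    exact kmap_inj x f hf 0 (by rw [this, map_zero])

/-- finitely generated modules have finitely generated Koszul cohomology -/
lemma kfin_of_finite [IsNoetherianRing A] [Module.Finite A M] (i : ℕ) : KFin x M i := by
  refine ⟨kZ x M i, ?_, le_sup_right⟩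
  exact IsNoetherian.noetherian _

/-- elements of the ideal generated by `x` kill Koszul cohomology -/
lemma smul_kZ (y : A) (hy : y ∈ Ideal.span (Set.range x)) (i : ℕ) (z : KoszulCochain x M i)
    (hz : z ∈ kZ x M i) : y • z ∈ koszulBoundary x M i := by
  induction hy using Submodule.span_induction with
  | mem y hy =>
    obtain ⟨j, rfl⟩ := hy
    exact x_smul_kZ x j M i z hz
  | zero => simp
  | add a b _ _ ha hb => rw [add_smul]; exact Submodule.add_mem _ ha hb
  | smul a b _ hb => rw [smul_assoc]; exact Submodule.smul_mem _ _ hb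

/-- if some `y` in the ideal is injective on `M` then `H^0 = 0` -/
lemma kfin_zero_of_inj (y : A) (hy : y ∈ Ideal.span (Set.range x))
    (hinj : ∀ m : M, y • m = 0 → m = 0) : KFin x M 0 := by
  refine RelFG.of_le fun z hz => ?_
  have h : y • z = 0 := smul_kZ x y hy 0 z hz
  have : z = 0 := by
    ext s
    exact hinj _ (congrFun h s)
  rw [this]
  exact Submodule.zero_mem _

/-- if some `y` in the ideal is bijective on `M` then all cohomology vanishes -/
lemma kfin_of_bij (y : A) (hy : y ∈ Ideal.span (Set.range x))
    (hinj : ∀ m : M, y • m = 0 → m = 0) (hsurj : ∀ m : M, ∃ n : M, y • n = m) (i : ℕ) :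
    KFin x M i := by
  cases i with
  | zero => exact kfin_zero_of_inj x y hy hinj
  | succ i =>
    refine RelFG.of_le fun z hz => ?_
    obtain ⟨c, hc⟩ := smul_kZ x y hy _ z hz
    choose n hn using hsurj
    refine ⟨fun s => n (c s), ?_⟩
    have h1 : y • (fun s => n (c s) : KoszulCochain x M i) = c := by
      ext s; exact hn _
    have h2 : y • (koszulD x M i (fun s => n (c s)) - z) = 0 := by
      rw [smul_sub, ← map_smul, h1, hc, sub_self]
    rw [← sub_eq_zero]
    ext s
    exact hinj _ (congrFun h2 s)

/-- the final step: multiplication by `y` -/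
lemma kfin_of_mul [IsNoetherianRing A] (y : A) (hy : y ∈ Ideal.span (Set.range x)) (i : ℕ)
    (hK : KFin x (LinearMap.ker (LinearMap.lsmul A M y)) (i + 1))
    (hQ : KFin x (M ⧸ LinearMap.range (LinearMap.lsmul A M y)) i) : KFin x M (i + 1) := by
  set μ := LinearMap.lsmul A M y with hμ
  refine les_a' x (LinearMap.ker μ).subtype μ.rangeRestrict (Submodule.subtype_injective _)
    μ.surjective_rangeRestrict ?_ (i + 1) hK _ le_rfl ?_
  · intro m
    simp only [Submodule.coe_subtype, Subtype.range_coe_subtype, Set.mem_setOf_eq]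
    rw [← Subtype.coe_inj]
    rfl
  · refine (les_c' x (LinearMap.range μ).subtype (LinearMap.range μ).mkQ
      (Submodule.subtype_injective _) (Submodule.mkQ_surjective _) ?_ i hQ).mono le_rfl ?_
    · intro m
      simp
    · rintro _ ⟨z, hz, rfl⟩
      refine ⟨kmap_Z x _ _ z hz, ?_⟩
      exact smul_kZ x y hy (i + 1) z hz

/-- `H^0` finitely generated gives `0 :_M I` finitely generated -/
lemma fg_of_kfin_zero (h : KFin x M 0) (V : Submodule A M) [IsNoetherianRing A]
    (hV : ∀ v ∈ V, ∀ j, x j • v = 0) : V.FG := by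
  obtain ⟨F, hF, h⟩ := h
  have hF' : IsNoetherian A (F.map (LinearMap.proj (R := A)
    (⟨∅, rfl⟩ : {s : Finset (Fin t) // s.card = 0}))) := isNoetherian_of_fg_of_noetherian _ (hF.map _)
  have hle : V ≤ (F.map (LinearMap.proj (R := A)
    (⟨∅, rfl⟩ : {s : Finset (Fin t) // s.card = 0}))) := by
    intro v hv
    have hz : (fun _ => v : KoszulCochain x M 0) ∈ kZ x M 0 := by
      rw [LinearMap.mem_ker]
      ext s
      simp [koszulD, LinearMap.sum_apply, mul_smul, hV v hv]
    have := h hz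
    simp only [koszulBoundary, bot_sup_eq] at this
    exact ⟨_, this, rfl⟩
  have := isNoetherian_of_le hle
  exact Submodule.FG.of_finite

end les

/-- every prime in the support is maximal -/
def MDim0 (A : Type) [CommRing A] (M : Type) [AddCommGroup M] [Module A M] : Prop :=
  ∀ (m : M) (p : Ideal A), p.IsPrime → (∀ a : A, a • m = 0 → a ∈ p) → p.IsMaximal

/-- no chains of length two in the support -/
def MDim1 (A : Type) [CommRing A] (M : Type) [AddCommGroup M] [Module A M] : Prop :=
  ∀ (m : M) (p q r : Ideal A), p.IsPrime → q.IsPrime → r.IsPrime → p < q → q < r →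
    (∀ a : A, a • m = 0 → a ∈ p) → False

section dims

variable {M N : Type} [AddCommGroup M] [Module A M] [AddCommGroup N] [Module A N]

lemma MDim0.of_inj (h : MDim0 A M) (f : N →ₗ[A] M) (hf : Function.Injective f) : MDim0 A N := by
  intro n p hp hn
  refine h (f n) p hp fun a ha => hn a (hf ?_)
  rw [map_smul, ha, map_zero]

lemma MDim0.of_surj (h : MDim0 A M) (f : M →ₗ[A] N) (hf : Function.Surjective f) :
    MDim0 A N := by
  intro n p hp hn
  obtain ⟨m, rfl⟩ := hf n
  refine h m p hp fun a ha => hn a ?_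
  rw [← map_smul, ha, map_zero]

lemma MDim1.of_inj (h : MDim1 A M) (f : N →ₗ[A] M) (hf : Function.Injective f) : MDim1 A N := by
  intro n p q r hp hq hr h1 h2 hn
  refine h (f n) p q r hp hq hr h1 h2 fun a ha => hn a (hf ?_)
  rw [map_smul, ha, map_zero]

lemma MDim1.of_surj (h : MDim1 A M) (f : M →ₗ[A] N) (hf : Function.Surjective f) :
    MDim1 A N := by
  intro n p q r hp hq hr h1 h2 hn
  obtain ⟨m, rfl⟩ := hf n
  refine h m p q r hp hq hr h1 h2 fun a ha => hn a ?_
  rw [← map_smul, ha, map_zero]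

lemma artinian_span_singleton [IsNoetherianRing A] (h : MDim0 A M) (m : M) :
    IsArtinian A (Submodule.span A {m}) := by
  let J : Ideal A := LinearMap.ker (LinearMap.toSpanSingleton A M m)
  have hJ : Ring.KrullDimLE 0 (A ⧸ J) := by
    rw [Ideal.krullDimLE_zero_quotient_iff_forall_minimalPrimes_isMaximal]
    intro p hp
    refine h m p hp.1.1 fun a ha => hp.1.2 ?_
    simpa [J] using ha
  have h1 : IsArtinianRing (A ⧸ J) := isArtinianRing_iff_krullDimLE_zero.2 hJ
  have h2 : IsArtinian A (A ⧸ J) :=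
    isArtinian_of_surjective_algebraMap (R := A ⧸ J) (Ideal.Quotient.mk_surjective)
  have h3 : IsArtinian A (LinearMap.range (LinearMap.toSpanSingleton A M m)) :=
    isArtinian_of_linearEquiv (LinearMap.quotKerEquivRange _)
  rwa [LinearMap.range_toSpanSingleton] at h3

lemma artinian_of_fg [IsNoetherianRing A] (h : MDim0 A M) (V : Submodule A M) (hV : V.FG) :
    IsArtinian A V := by
  obtain ⟨S, rfl⟩ := hV
  rw [← Set.biUnion_of_singleton (S : Set M), Submodule.span_iUnion₂]
  have : ∀ s : S, IsArtinian A (Submodule.span A {(s : M)}) :=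
    fun s => artinian_span_singleton h s
  have h2 := isArtinian_iSup (R := A) (M := fun s : S => Submodule.span A {(s : M)})
  rwa [iSup_subtype] at h2

lemma artinian_one (a : A) (ht : ∀ m : M, ∃ n : ℕ, a ^ n • m = 0)
    (hk : IsArtinian A (LinearMap.ker (LinearMap.lsmul A M a))) : IsArtinian A M := by
  rw [← monotone_stabilizes_iff_artinian]
  intro f
  let g : ℕ → Submodule A M := fun n => OrderDual.ofDual (f n)
  have hg : ∀ n m, n ≤ m → g m ≤ g n := fun n m h => f.monotone h
  set K := LinearMap.ker (LinearMap.lsmul A M a) with hK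
  let V : ℕ → ℕ → Submodule A K := fun n k =>
    ((g n).map (LinearMap.lsmul A M (a ^ k))).comap K.subtype
  have hV : ∀ n m k l, n ≤ m → k ≤ l → V m l ≤ V n k := by
    rintro n m k l hnm hkl v ⟨w, hw, hwv⟩
    refine ⟨a ^ (l - k) • w, Submodule.smul_mem _ _ (hg n m hnm hw), ?_⟩
    rw [← hwv]
    simp only [LinearMap.lsmul_apply, smul_smul, ← pow_add]
    congr 2
    omega
  have st : ∀ F : ℕ → Submodule A K, (∀ n m, n ≤ m → F m ≤ F n) →
      ∃ n, ∀ m, n ≤ m → F n = F m := by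
    intro F hF
    exact monotone_stabilizes_iff_artinian.2 hk
      ⟨fun n => OrderDual.toDual (F n), fun n m h => hF n m h⟩
  obtain ⟨N, hN⟩ := st (fun k => V k k) (fun n m h => hV _ _ _ _ h h)
  have hk' : ∀ k, ∃ n, ∀ m, n ≤ m → V n k = V m k := fun k =>
    st (fun n => V n k) (fun n m h => hV _ _ _ _ h le_rfl)
  choose Nk hNk using hk'
  let n0 := max N ((Finset.range N).sup Nk)
  have key : ∀ m, n0 ≤ m → ∀ k, V n0 k ≤ V m k := by
    intro m hm k
    by_cases hkN : k < N
    · have h1 : Nk k ≤ n0 := le_max_of_le_right (Finset.le_sup (Finset.mem_range.2 hkN))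
      rw [← hNk k n0 h1, ← hNk k m (h1.trans hm)]
    · push Not at hkN
      have h1 : V n0 k ≤ V N N := hV _ _ _ _ (le_max_left _ _) hkN
      have h2 : V (max m k) (max m k) ≤ V m k := hV _ _ _ _ (le_max_left _ _) (le_max_right _ _)
      refine h1.trans (le_trans ?_ h2)
      exact (hN _ (hkN.trans (le_max_right _ _))).le
  refine ⟨n0, fun m hm => ?_⟩
  have hgoal : g n0 ≤ g m := by
    have : ∀ k : ℕ, ∀ w ∈ g n0, a ^ k • w = 0 → w ∈ g m := by
      intro k
      induction k with
      | zero => intro w _ h; simp at h; rw [h]; exact Submodule.zero_mem _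
      | succ k ih =>
        intro w hw h
        have hwK : a ^ k • w ∈ K := by
          rw [hK, LinearMap.mem_ker, LinearMap.lsmul_apply, smul_smul, ← pow_succ', h]
        have h1 : (⟨a ^ k • w, hwK⟩ : K) ∈ V n0 k := ⟨w, hw, rfl⟩
        obtain ⟨w', hw', he⟩ := key m hm k h1
        have h2 := ih (w - w') (Submodule.sub_mem _ hw (hg _ _ hm hw')) (by
          have he' : a ^ k • w' = a ^ k • w := he
          rw [smul_sub, he', sub_self])
        have h3 : w = (w - w') + w' := by abel
        rw [h3]
        exact Submodule.add_mem _ h2 hw'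
    intro w hw
    obtain ⟨k, hk⟩ := ht w
    exact this k w hw hk
  exact (le_antisymm (hg _ _ hm : g m ≤ g n0) hgoal).symm

end dims

lemma artinian_many (s : Finset A) : ∀ (M : Type) [AddCommGroup M] [Module A M],
    (∀ m : M, ∀ a ∈ s, ∃ n : ℕ, a ^ n • m = 0) →
    (∀ V : Submodule A M, (∀ v ∈ V, ∀ a ∈ s, a • v = 0) → IsArtinian A V) → IsArtinian A M := by
  classical
  induction s using Finset.induction with
  | empty =>
    intro M _ _ _ h
    have := h ⊤ (by simp)
    exact isArtinian_of_linearEquiv (Submodule.topEquiv (R := A) (M := M))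
  | insert a s _ ih =>
    intro M _ _ ht h
    refine artinian_one a (fun m => ht m a (by simp)) ?_
    refine ih _ ?_ ?_
    · intro m b hb
      obtain ⟨n, hn⟩ := ht m b (by simp [hb])
      exact ⟨n, Subtype.ext hn⟩
    · intro V hV
      have h1 := h (V.map (Submodule.subtype _)) (by
        rintro _ ⟨v, hv, rfl⟩ b hb
        rcases Finset.mem_insert.1 hb with rfl | hb
        · exact v.2
        · exact congrArg Subtype.val (hV v hv b hb))
      exact isArtinian_of_linearEquiv
        (Submodule.equivMapOfInjective _ (Submodule.subtype_injective _) V).symm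

lemma noetherian_one (a : A) (n : ℕ) : ∀ (M : Type) [AddCommGroup M] [Module A M],
    (∀ m : M, a ^ n • m = 0) →
    IsNoetherian A (LinearMap.ker (LinearMap.lsmul A M a)) → IsNoetherian A M := by
  induction n with
  | zero =>
    intro M _ _ h _
    have : Subsingleton M := ⟨fun x y => by
      have h1 := h x
      have h2 := h y
      simp at h1 h2
      rw [h1, h2]⟩
    infer_instance
  | succ n ih =>
    intro M _ _ h hk
    set μ := LinearMap.lsmul A M a
    have h1 : IsNoetherian A (LinearMap.range μ) := by
      refine ih _ ?_ ?_
      · rintro ⟨_, ⟨m, rfl⟩⟩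
        ext
        have := h m
        rw [pow_succ, mul_smul] at this
        exact this
      · let j : LinearMap.ker (LinearMap.lsmul A (LinearMap.range μ) a) →ₗ[A] LinearMap.ker μ :=
          ((LinearMap.range μ).subtype ∘ₗ Submodule.subtype _).codRestrict _ (by
            rintro ⟨⟨v, hv⟩, hv'⟩
            exact congrArg Subtype.val (LinearMap.mem_ker.1 hv'))
        refine isNoetherian_of_injective j ?_
        intro u v huv
        have huv' : ((j u : LinearMap.ker μ) : M) = (j v : LinearMap.ker μ) := by rw [huv]
        exact Subtype.ext (Subtype.ext huv')
    refine isNoetherian_of_range_eq_ker (LinearMap.ker μ).subtype μ.rangeRestrict ?_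
    rw [Submodule.range_subtype, LinearMap.ker_rangeRestrict]

lemma noetherian_many (s : Finset A) : ∀ (M : Type) [AddCommGroup M] [Module A M],
    (∀ a ∈ s, ∃ n : ℕ, ∀ m : M, a ^ n • m = 0) →
    (∀ V : Submodule A M, (∀ v ∈ V, ∀ a ∈ s, a • v = 0) → IsNoetherian A V) →
    IsNoetherian A M := by
  classical
  induction s using Finset.induction with
  | empty =>
    intro M _ _ _ h
    have := h ⊤ (by simp)
    exact isNoetherian_of_linearEquiv (Submodule.topEquiv (R := A) (M := M))
  | insert a s _ ih =>
    intro M _ _ ht h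
    obtain ⟨n, hn⟩ := ht a (by simp)
    refine noetherian_one a n M hn ?_
    refine ih _ ?_ ?_
    · intro b hb
      obtain ⟨n, hn⟩ := ht b (by simp [hb])
      exact ⟨n, fun m => Subtype.ext (hn m)⟩
    · intro V hV
      have h1 := h (V.map (Submodule.subtype _)) (by
        rintro _ ⟨v, hv, rfl⟩ b hb
        rcases Finset.mem_insert.1 hb with rfl | hb
        · exact v.2
        · exact congrArg Subtype.val (hV v hv b hb))
      exact isNoetherian_of_linearEquiv
        (Submodule.equivMapOfInjective _ (Submodule.subtype_injective _) V).symm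

section art

variable {M : Type} [AddCommGroup M] [Module A M]

lemma supIrred_dichotomy [IsArtinian A M] (S : Submodule A M) (hS : SupIrred S) (a : A) :
    (∃ n : ℕ, ∀ s ∈ S, a ^ n • s = 0) ∨ (∀ s ∈ S, ∃ s' ∈ S, a • s' = s) := by
  obtain ⟨n, hn⟩ := IsArtinian.range_smul_pow_stabilizes S a
  have hfit : (S ⊓ LinearMap.ker (LinearMap.lsmul A M (a ^ (n + 1)))) ⊔
      S.map (LinearMap.lsmul A M (a ^ (n + 1))) = S := by
    apply le_antisymm
    · refine sup_le inf_le_left ?_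
      rintro _ ⟨s, hs, rfl⟩
      exact S.smul_mem _ hs
    · intro s hs
      have h1 : a ^ (n + 1) • (⟨s, hs⟩ : S) ∈
          LinearMap.range (a ^ (n + 1) • LinearMap.id : S →ₗ[A] S) := ⟨⟨s, hs⟩, rfl⟩
      rw [← hn (n + 1) (by omega), hn ((n + 1) + (n + 1)) (by omega)] at h1
      obtain ⟨s', hs'⟩ := h1
      have h2 : a ^ (n + 1) • (a ^ (n + 1) • s'.1) = a ^ (n + 1) • s := by
        rw [smul_smul, ← pow_add]
        exact congrArg Subtype.val hs'
      have h3 : s = (s - a ^ (n + 1) • s'.1) + a ^ (n + 1) • s'.1 := by abel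
      rw [h3]
      refine Submodule.add_mem_sup ⟨S.sub_mem hs (S.smul_mem _ s'.2), ?_⟩ ⟨s', s'.2, rfl⟩
      rw [SetLike.mem_coe, LinearMap.mem_ker, LinearMap.lsmul_apply, smul_sub, h2, sub_self]
  rcases hS.2 hfit with h | h
  · left
    refine ⟨n + 1, fun s hs => ?_⟩
    rw [← h] at hs
    exact hs.2
  · right
    intro s hs
    rw [← h] at hs
    obtain ⟨s', hs', he⟩ := hs
    refine ⟨a ^ n • s', S.smul_mem _ hs', ?_⟩
    rw [smul_smul, ← pow_succ']
    exact he

lemma pow_surj (S : Submodule A M) (a : A) (h : ∀ s ∈ S, ∃ s' ∈ S, a • s' = s) (n : ℕ) :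
    ∀ s ∈ S, ∃ s' ∈ S, a ^ n • s' = s := by
  induction n with
  | zero => intro s hs; exact ⟨s, hs, by simp⟩
  | succ n ih =>
    intro s hs
    obtain ⟨s1, h1, e1⟩ := ih s hs
    obtain ⟨s2, h2, e2⟩ := h s1 h1
    exact ⟨s2, h2, by rw [pow_succ, mul_smul, e2, e1]⟩

/-- the prime attached to a sup-irreducible submodule -/
lemma exists_attached [IsArtinian A M] (S : Submodule A M) (hS : SupIrred S) :
    ∃ p : Ideal A, p.IsPrime ∧ (∀ a ∈ p, ∃ n : ℕ, ∀ s ∈ S, a ^ n • s = 0) ∧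
      (∀ a, a ∉ p → ∀ s ∈ S, ∃ s' ∈ S, a • s' = s) := by
  have hmem : ∀ a, a ∈ S.annihilator.radical ↔ ∃ n : ℕ, ∀ s ∈ S, a ^ n • s = 0 := by
    intro a
    rw [Ideal.mem_radical_iff]
    simp only [Submodule.mem_annihilator]
  have hdi : ∀ a, a ∉ S.annihilator.radical → ∀ s ∈ S, ∃ s' ∈ S, a • s' = s := by
    intro a ha
    rcases supIrred_dichotomy S hS a with h | h
    · exact absurd ((hmem a).2 h) ha
    · exact h
  have hnot : ∀ a, (∀ s ∈ S, ∃ s' ∈ S, a • s' = s) → a ∉ S.annihilator.radical := by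
    intro a h ha
    obtain ⟨n, hn⟩ := (hmem a).1 ha
    apply hS.ne_bot
    rw [Submodule.eq_bot_iff]
    intro s hs
    obtain ⟨s', hs', rfl⟩ := pow_surj S a h n s hs
    exact hn s' hs'
  refine ⟨S.annihilator.radical, ⟨?_, ?_⟩, fun a ha => (hmem a).1 ha, hdi⟩
  · rw [Ideal.ne_top_iff_one]
    exact hnot 1 fun s hs => ⟨s, hs, one_smul _ _⟩
  · intro a b hab
    by_contra! hcon
    refine hnot (a * b) (fun s hs => ?_) hab
    obtain ⟨s1, h1, rfl⟩ := hdi a hcon.1 s hs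
    obtain ⟨s2, h2, rfl⟩ := hdi b hcon.2 s1 h1
    exact ⟨s2, h2, mul_smul _ _ _⟩

lemma art_main [IsNoetherianRing A] {t : ℕ} (x : Fin t → A)
    (htor : ∀ (m : M) (j : Fin t), ∃ n : ℕ, x j ^ n • m = 0) (hdim : MDim0 A M)
    (hV : ∀ V : Submodule A M, (∀ v ∈ V, ∀ j, x j • v = 0) → V.FG) :
    ∃ (L : Submodule A M) (P : Finset (Ideal A)), L.FG ∧
      (∀ p ∈ P, p.IsPrime ∧ ∃ j, x j ∉ p) ∧
      ∀ y : A, (∀ p ∈ P, y ∉ p) → ∀ m : M, ∃ l ∈ L, ∃ m' : M, m = l + y • m' := by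
  classical
  have hart : IsArtinian A M := by
    refine artinian_many (Finset.univ.image x) M ?_ ?_
    · intro m a ha
      obtain ⟨j, -, rfl⟩ := Finset.mem_image.1 ha
      exact htor m j
    · intro V h
      exact artinian_of_fg hdim V (hV V fun v hv j => h v hv _ (by simp))
  obtain ⟨s, hs, hirr⟩ := exists_supIrred_decomposition (⊤ : Submodule A M)
  have : ∀ S : s, ∃ p : Ideal A, p.IsPrime ∧ (∀ a ∈ p, ∃ n : ℕ, ∀ s ∈ S.1, a ^ n • s = 0) ∧
      (∀ a, a ∉ p → ∀ s ∈ S.1, ∃ s' ∈ S.1, a • s' = s) :=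
    fun S => exists_attached S.1 (hirr S.2)
  choose p hp hp1 hp2 using this
  refine ⟨(s.attach.filter (fun S => ∀ j, x j ∈ p S)).sup (fun S => S.1),
    (s.attach.filter (fun S => ¬ ∀ j, x j ∈ p S)).image p, ?_, ?_, ?_⟩
  · refine Submodule.fg_finset_sup _ _ ?_
    intro S hS
    have hS' := (Finset.mem_filter.1 hS).2
    have hN : IsNoetherian A S.1 := by
      refine noetherian_many (Finset.univ.image x) _ ?_ ?_
      · intro a ha
        obtain ⟨j, -, rfl⟩ := Finset.mem_image.1 ha
        obtain ⟨n, hn⟩ := hp1 S _ (hS' j)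
        exact ⟨n, fun m => Subtype.ext (hn m.1 m.2)⟩
      · intro V h
        have h1 : (V.map S.1.subtype).FG := hV _ (by
          rintro _ ⟨v, hv, rfl⟩ j
          exact congrArg Subtype.val (h v hv (x j) (by simp)))
        have h2 := isNoetherian_of_fg_of_noetherian _ h1
        exact isNoetherian_of_linearEquiv
          (Submodule.equivMapOfInjective _ (Submodule.subtype_injective _) V).symm
    exact Submodule.FG.of_finite
  · intro q hq
    obtain ⟨S, hS, rfl⟩ := Finset.mem_image.1 hq
    refine ⟨hp S, ?_⟩
    have := (Finset.mem_filter.1 hS).2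
    push Not at this
    exact this
  · intro y hy m
    have hm : m ∈ s.sup id := by rw [hs]; trivial
    have hle : s.sup id ≤ (s.attach.filter (fun S => ∀ j, x j ∈ p S)).sup (fun S => S.1) ⊔
        LinearMap.range (LinearMap.lsmul A M y) := by
      refine Finset.sup_le fun S hS => ?_
      by_cases h : ∀ j, x j ∈ p ⟨S, hS⟩
      · refine le_sup_of_le_left ?_
        exact Finset.le_sup (f := fun S : s => S.1) (b := ⟨S, hS⟩) (by simp [h])
      · refine le_sup_of_le_right ?_
        intro w hw
        obtain ⟨w', _, he⟩ := hp2 ⟨S, hS⟩ y (hy _ (Finset.mem_image.2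
          ⟨⟨S, hS⟩, Finset.mem_filter.2 ⟨Finset.mem_attach _ _, h⟩, rfl⟩)) w hw
        exact ⟨w', he⟩
    obtain ⟨l, hl, _, ⟨m', rfl⟩, he⟩ := Submodule.mem_sup.1 (hle hm)
    exact ⟨l, hl, m', he.symm⟩

end art

/-- `M` is torsion with respect to every `x j` -/
def MTor {t : ℕ} (x : Fin t → A) (M : Type) [AddCommGroup M] [Module A M] : Prop :=
  ∀ (m : M) (j : Fin t), ∃ n : ℕ, x j ^ n • m = 0

lemma MTor.of_inj {t : ℕ} {x : Fin t → A} {M N : Type} [AddCommGroup M] [Module A M]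
    [AddCommGroup N] [Module A N] (h : MTor x M) (f : N →ₗ[A] M) (hf : Function.Injective f) :
    MTor x N := by
  intro m j
  obtain ⟨n, hn⟩ := h (f m) j
  exact ⟨n, hf (by rw [map_smul, hn, map_zero])⟩

lemma MTor.of_surj {t : ℕ} {x : Fin t → A} {M N : Type} [AddCommGroup M] [Module A M]
    [AddCommGroup N] [Module A N] (h : MTor x M) (f : M →ₗ[A] N) (hf : Function.Surjective f) :
    MTor x N := by
  intro m j
  obtain ⟨m, rfl⟩ := hf m
  obtain ⟨n, hn⟩ := h m j
  exact ⟨n, by rw [← map_smul, hn, map_zero]⟩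

lemma exists_avoid {t : ℕ} (x : Fin t → A) (P : Finset (Ideal A))
    (hP : ∀ p ∈ P, p.IsPrime ∧ ∃ j, x j ∉ p) :
    ∃ y ∈ Ideal.span (Set.range x), ∀ p ∈ P, y ∉ p := by
  by_contra! hcon
  have h1 : ((Ideal.span (Set.range x) : Ideal A) : Set A) ⊆
      ⋃ i ∈ (↑P : Set (Ideal A)), ((id i : Ideal A) : Set A) := by
    intro y hy
    obtain ⟨p, hp, hyp⟩ := hcon y hy
    simp only [Set.mem_iUnion]
    exact ⟨p, hp, hyp⟩
  obtain ⟨p, hp, hle⟩ := (Ideal.subset_union_prime (f := id) ⊤ ⊤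
    (fun p hp _ _ => (hP p hp).1)).1 h1
  obtain ⟨j, hj⟩ := (hP p hp).2
  exact hj (hle (Ideal.subset_span ⟨j, rfl⟩))

lemma exact_sub_mkQ {M : Type} [AddCommGroup M] [Module A M] (L : Submodule A M) :
    Function.Exact L.subtype L.mkQ := LinearMap.exact_subtype_mkQ L

lemma exact_ker_range {M : Type} [AddCommGroup M] [Module A M] (μ : M →ₗ[A] M) :
    Function.Exact (LinearMap.ker μ).subtype μ.rangeRestrict := by
  rw [LinearMap.exact_iff, Submodule.range_subtype, LinearMap.ker_rangeRestrict]

/-- dimension zero, torsion case -/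
lemma kfin_T0 [IsNoetherianRing A] {t : ℕ} (x : Fin t → A) (J : Ideal A) :
    ∀ (M : Type) [AddCommGroup M] [Module A M], (∀ a ∈ J, ∀ m : M, a • m = 0) →
    MTor x M → MDim0 A M → KFin x M 0 → ∀ i, KFin x M i := by
  induction J using WellFoundedGT.induction with
  | ind J ih =>
  intro M _ _ hJ htor hdim h0 i
  obtain ⟨L, P, hL, hP, hLP⟩ := art_main x htor hdim (fun V hV => fg_of_kfin_zero x h0 V hV)
  obtain ⟨y, hyI, hyP⟩ := exists_avoid x P hP
  have hLf : Module.Finite A L := Module.Finite.iff_fg.2 hL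
  have hsurj : ∀ q : M ⧸ L, ∃ q', y • q' = q := by
    intro q
    obtain ⟨m, rfl⟩ := Submodule.mkQ_surjective L q
    obtain ⟨l, hl, m', rfl⟩ := hLP y hyP m
    refine ⟨L.mkQ m', ?_⟩
    have : L.mkQ l = 0 := (Submodule.Quotient.mk_eq_zero L).2 hl
    rw [map_add, this, zero_add, map_smul]
  have hQ0 : KFin x (M ⧸ L) 0 :=
    les_b x L.subtype L.mkQ (Submodule.subtype_injective _) (Submodule.mkQ_surjective _)
      (exact_sub_mkQ L) 0 h0 (kfin_of_finite x 1)
  refine les_a x L.subtype L.mkQ (Submodule.subtype_injective _) (Submodule.mkQ_surjective _)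
      (exact_sub_mkQ L) i (kfin_of_finite x i) ?_
  have hJQ : ∀ a ∈ J, ∀ q : M ⧸ L, a • q = 0 := by
    intro a ha q
    obtain ⟨m, rfl⟩ := Submodule.mkQ_surjective L q
    rw [← map_smul, hJ a ha m, map_zero]
  by_cases hyJ : y ∈ J
  · have : Subsingleton (M ⧸ L) := by
      refine ⟨fun a b => ?_⟩
      obtain ⟨a, rfl⟩ := hsurj a
      obtain ⟨b, rfl⟩ := hsurj b
      rw [hJQ y hyJ, hJQ y hyJ]
    exact kfin_of_finite x i
  · cases i with
    | zero => exact hQ0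
    | succ i =>
      have hsub : Subsingleton ((M ⧸ L) ⧸ LinearMap.range (LinearMap.lsmul A (M ⧸ L) y)) := by
        rw [Submodule.Quotient.subsingleton_iff, LinearMap.range_eq_top]
        exact hsurj
      refine kfin_of_mul x y hyI i ?_ (kfin_of_finite x i)
      refine ih (J ⊔ Ideal.span {y}) ?_ _ ?_ ?_ ?_ ?_ (i + 1)
      · refine lt_of_le_of_ne le_sup_left fun h => hyJ ?_
        rw [h]
        exact Ideal.mem_sup_right (Ideal.mem_span_singleton_self y)
      · intro a ha k
        obtain ⟨b, hb, c, hc, rfl⟩ := Submodule.mem_sup.1 ha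
        obtain ⟨d, rfl⟩ := Ideal.mem_span_singleton'.1 hc
        have h1 : y • k = 0 := Subtype.ext k.2
        have h2 : b • k = 0 := Subtype.ext (hJQ b hb k.1)
        rw [add_smul, mul_smul, h1, h2, smul_zero, add_zero]
      · exact (htor.of_surj L.mkQ (Submodule.mkQ_surjective _)).of_inj
          (Submodule.subtype _) (Submodule.subtype_injective _)
      · exact (hdim.of_surj L.mkQ (Submodule.mkQ_surjective _)).of_inj
          (Submodule.subtype _) (Submodule.subtype_injective _)
      · exact les_c0 x (Submodule.subtype _) (Submodule.subtype_injective _) hQ0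

/-- nonmaximal primes in the support -/
def nmSupp (A : Type) [CommRing A] (M : Type) [AddCommGroup M] [Module A M] : Set (Ideal A) :=
  {p | p.IsPrime ∧ ¬ p.IsMaximal ∧ ∃ m : M, ∀ a : A, a • m = 0 → a ∈ p}

lemma exists_prime_gt_of_not_max (p : Ideal A) (hp : p.IsPrime) (h : ¬ p.IsMaximal) :
    ∃ r : Ideal A, r.IsPrime ∧ p < r := by
  obtain ⟨r, hr, hle⟩ := Ideal.exists_le_maximal p hp.ne_top
  exact ⟨r, hr.isPrime, lt_of_le_of_ne hle fun e => h (e ▸ hr)⟩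

lemma nmSupp_finite [IsNoetherianRing A] {t : ℕ} (x : Fin t → A) {M : Type} [AddCommGroup M]
    [Module A M] (htor : MTor x M) (hdim : MDim1 A M) (h0 : KFin x M 0) :
    (nmSupp A M).Finite := by
  let K : Submodule A M := ⨅ j, LinearMap.ker (LinearMap.lsmul A M (x j))
  have hKm : ∀ m, m ∈ K ↔ ∀ j, x j • m = 0 := by intro m; simp [K]
  have hK : K.FG := fg_of_kfin_zero x h0 K fun v hv j => (hKm v).1 hv j
  have hKf : Module.Finite A K := Module.Finite.iff_fg.2 hK
  refine (associatedPrimes.finite A K).subset ?_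
  rintro p ⟨hp, hnm, m, hm⟩
  obtain ⟨r, hr, hpr⟩ := exists_prime_gt_of_not_max p hp hnm
  have hann : ∀ a, a ∈ Module.annihilator A (Submodule.span A {m}) ↔ a • m = 0 := by
    intro a
    rw [← Submodule.annihilator, Submodule.mem_annihilator_span_singleton]
  have hmin : p ∈ (Module.annihilator A (Submodule.span A {m})).minimalPrimes := by
    refine ⟨⟨hp, fun a ha => hm a ((hann a).1 ha)⟩, ?_⟩
    rintro q ⟨hq, hqa⟩ hqp
    by_contra hcon
    refine hdim m q p r hq hp hr (lt_of_le_not_ge hqp hcon) hpr fun a ha => ?_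
    exact hqa ((hann a).2 ha)
  have hass := Module.associatedPrimes.minimalPrimes_annihilator_subset_associatedPrimes A _ hmin
  rw [AssociatedPrimes.mem_iff, isAssociatedPrime_iff] at hass ⊢
  refine ⟨hp, ?_⟩
  obtain ⟨-, ⟨k, hk⟩, he⟩ := hass
  have hkm : ∀ a, a ∈ p ↔ a • k = 0 := by
    intro a
    rw [he, Submodule.mem_colon_singleton, Submodule.mem_bot, ← Subtype.coe_inj]
    rfl
  have hkK : k ∈ K := by
    rw [hKm]
    intro j
    obtain ⟨n, hn⟩ := htor m j
    rw [← hkm]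
    exact hp.mem_of_pow_mem n (hm _ hn)
  refine ⟨⟨k, hkK⟩, ?_⟩
  ext a
  rw [hkm, Submodule.mem_colon_singleton, Submodule.mem_bot, ← Subtype.coe_inj]
  rfl

/-- complement of the union of the nonmaximal primes of the support -/
def nmCompl (A : Type) [CommRing A] (M : Type) [AddCommGroup M] [Module A M] : Submonoid A where
  carrier := {a | ∀ p ∈ nmSupp A M, a ∉ p}
  one_mem' := fun p hp h => hp.1.ne_top ((Ideal.eq_top_iff_one p).2 h)
  mul_mem' := fun {a b} ha hb p hp h => by
    rcases hp.1.mem_or_mem h with h | h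
    · exact ha p hp h
    · exact hb p hp h

lemma loc_main [IsNoetherianRing A] {t : ℕ} (x : Fin t → A) {M : Type} [AddCommGroup M]
    [Module A M] (htor : MTor x M) (hdim : MDim1 A M) (h0 : KFin x M 0) :
    ∃ (L : Submodule A M) (y : A), L.FG ∧ y ∈ Ideal.span (Set.range x) ∧
      ∀ (m : M) (p : Ideal A), p.IsPrime →
        (∀ a : A, (∃ l ∈ L, ∃ m' : M, a • m = l + y • m') → a ∈ p) → p.IsMaximal := by
  classical
  have hfin := nmSupp_finite x htor hdim h0
  let K : Submodule A M := ⨅ j, LinearMap.ker (LinearMap.lsmul A M (x j))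
  have hKm : ∀ m, m ∈ K ↔ ∀ j, x j • m = 0 := by intro m; simp [K]
  have hK : K.FG := fg_of_kfin_zero x h0 K fun v hv j => (hKm v).1 hv j
  let S := nmCompl A M
  let AS := Localization S
  let MS := LocalizedModule S M
  let ι : M →ₗ[A] MS := LocalizedModule.mkLinearMap S M
  have hsurj : ∀ v : MS, ∃ (m : M) (s : A), s ∈ S ∧ s • v = ι m := by
    intro v
    obtain ⟨⟨m, s⟩, h⟩ := IsLocalizedModule.surj S ι v
    exact ⟨m, s, s.2, h⟩
  have heq : ∀ m n : M, ι m = ι n → ∃ s ∈ S, s • m = s • n := by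
    intro m n h
    obtain ⟨s, hs⟩ := IsLocalizedModule.exists_of_eq (S := S) (f := ι) h
    exact ⟨s, s.2, hs⟩
  have hunit : ∀ s ∈ S, IsUnit (algebraMap A AS s) :=
    fun s hs => IsLocalization.map_units AS (⟨s, hs⟩ : S)
  have hcanc : ∀ s ∈ S, ∀ v : MS, s • v = 0 → v = 0 := by
    intro s hs v h
    rw [← algebraMap_smul AS s v] at h
    exact (hunit s hs).smul_eq_zero.1 h
  -- primes in the localization
  have hprime : ∀ (n : M) (q : Ideal A), q.IsPrime → (∀ a, a • n = 0 → a ∈ q) →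
      (∀ s ∈ S, s ∉ q) → q ∈ nmSupp A M := by
    intro n q hq hn hqS
    have h1 : (q : Set A) ⊆ ⋃ i ∈ (↑hfin.toFinset : Set (Ideal A)), ((id i : Ideal A) : Set A) := by
      intro a ha
      have : ¬ a ∈ S := fun h => hqS a h ha
      have h2 : ¬ ∀ p ∈ nmSupp A M, a ∉ p := this
      push Not at h2
      obtain ⟨p, hp, hap⟩ := h2
      simp only [Set.mem_iUnion]
      exact ⟨p, by simpa using hp, hap⟩
    obtain ⟨p, hp, hle⟩ := (Ideal.subset_union_prime (f := id) ⊤ ⊤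
      (fun p hp _ _ => ((hfin.mem_toFinset).1 hp).1)).1 h1
    have hp' := (hfin.mem_toFinset).1 hp
    obtain ⟨r, hr, hpr⟩ := exists_prime_gt_of_not_max p hp'.1 hp'.2.1
    by_cases he : q = p
    · rw [he]; exact hp'
    · exact (hdim n q p r hq hp'.1 hr (lt_of_le_of_ne hle he) hpr hn).elim
  have hdimS : MDim0 AS MS := by
    intro v Q hQ hv
    obtain ⟨n, s, hs, hn⟩ := hsurj v
    have hcm : ∀ Q' : Ideal AS, Q'.IsPrime → Q ≤ Q' →
        Q'.comap (algebraMap A AS) ∈ nmSupp A M ∧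
        ∀ a, a • n = 0 → a ∈ Q'.comap (algebraMap A AS) := by
      intro Q' hQ' hle
      have h1 : ∀ a, a • n = 0 → a ∈ Q'.comap (algebraMap A AS) := by
        intro a ha
        rw [Ideal.mem_comap]
        refine hle (hv _ ?_)
        rw [algebraMap_smul]
        apply hcanc s hs
        rw [smul_comm, hn, ← map_smul, ha, map_zero]
      refine ⟨hprime n _ (Ideal.comap_isPrime _ _) h1 ?_, h1⟩
      intro s hs hmem
      exact hQ'.ne_top (Ideal.eq_top_of_isUnit_mem _ hmem (hunit s hs))
    obtain ⟨Q', hQ', hle⟩ := Ideal.exists_le_maximal Q hQ.ne_top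
    obtain ⟨hq, hqn⟩ := hcm Q hQ le_rfl
    obtain ⟨hq', -⟩ := hcm Q' hQ'.isPrime hle
    obtain ⟨r, hr, hpr⟩ := exists_prime_gt_of_not_max _ hq'.1 hq'.2.1
    have he : Q.comap (algebraMap A AS) = Q'.comap (algebraMap A AS) := by
      by_contra hne
      exact hdim n _ _ r hq.1 hq'.1 hr (lt_of_le_of_ne (Ideal.comap_mono hle) hne) hpr hqn
    have : Q = Q' := by
      have he2 : Ideal.under A Q = Ideal.under A Q' := he
      rw [← IsLocalization.map_under S AS Q, he2, IsLocalization.map_under S AS Q']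
    rw [this]
    exact hQ'
  have htorS : MTor (fun j => algebraMap A AS (x j)) MS := by
    intro v j
    obtain ⟨n, s, hs, hn⟩ := hsurj v
    obtain ⟨k, hk⟩ := htor n j
    refine ⟨k, ?_⟩
    rw [← map_pow, algebraMap_smul]
    apply hcanc s hs
    rw [smul_comm, hn, ← map_smul, hk, map_zero]
  have hVS : ∀ V : Submodule AS MS, (∀ v ∈ V, ∀ j, algebraMap A AS (x j) • v = 0) → V.FG := by
    intro V hV
    obtain ⟨G, hG⟩ := hK
    let W : Submodule AS MS := Submodule.span AS (ι '' (G : Set M))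
    have hKW : ∀ k ∈ K, ι k ∈ W := by
      intro k hk
      rw [← hG] at hk
      have h1 : Submodule.span A (G : Set M) ≤ (W.restrictScalars A).comap ι := by
        rw [Submodule.span_le]
        intro g hg
        exact Submodule.subset_span ⟨g, hg, rfl⟩
      exact h1 hk
    have hWN : IsNoetherian AS W := isNoetherian_of_fg_of_noetherian _
      (Submodule.fg_span (G.finite_toSet.image ι))
    have hle : V ≤ W := by
      intro v hv
      obtain ⟨n, s, hs, hn⟩ := hsurj v
      have hu : ∀ j, ∃ u ∈ S, u • (x j • n) = 0 := by
        intro j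
        have h1 : ι (x j • n) = ι 0 := by
          rw [map_smul, ← hn, smul_comm, ← algebraMap_smul AS (x j) v, hV v hv j, smul_zero,
            map_zero]
        obtain ⟨u, hu, h2⟩ := heq _ _ h1
        exact ⟨u, hu, by rw [h2, smul_zero]⟩
      choose u hu hun using hu
      have hpS : (∏ j, u j) ∈ S := Submonoid.prod_mem _ fun j _ => hu j
      have hmem : (∏ j, u j) • n ∈ K := by
        rw [hKm]
        intro j
        rw [smul_comm, ← Finset.prod_erase_mul _ _ (Finset.mem_univ j), mul_smul, hun, smul_zero]
      have h3 := hKW _ hmem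
      rw [map_smul, ← hn, smul_smul, ← algebraMap_smul AS] at h3
      exact (Submodule.smul_mem_iff_of_isUnit W (hunit _ (S.mul_mem hpS hs))).1 h3
    have := isNoetherian_of_le hle
    exact Submodule.FG.of_finite
  obtain ⟨L', P', hL', hP', hLP⟩ := art_main (A := AS) (fun j => algebraMap A AS (x j))
    htorS hdimS hVS
  obtain ⟨y, hyI, hyP⟩ := exists_avoid x (P'.image (Ideal.comap (algebraMap A AS))) (by
    intro p hp
    obtain ⟨q, hq, rfl⟩ := Finset.mem_image.1 hp
    obtain ⟨hq1, j, hj⟩ := hP' q hq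
    exact ⟨Ideal.comap_isPrime _ _, j, hj⟩)
  have hLP := hLP (algebraMap A AS y) (fun p hp h => hyP _ (Finset.mem_image_of_mem _ hp) h)
  -- numerators of generators
  obtain ⟨G, rfl⟩ := hL'
  choose num den hden hnum using hsurj
  refine ⟨Submodule.span A (num '' (G : Set MS)), y,
    Submodule.fg_span (G.finite_toSet.image num), hyI, ?_⟩
  have hLift : ∀ l' ∈ Submodule.span AS (G : Set MS), ∃ s ∈ S,
      ∃ l ∈ Submodule.span A (num '' (G : Set MS)), s • l' = ι l := by
    intro l' hl'
    induction hl' using Submodule.span_induction with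
    | mem g hg => exact ⟨den g, hden g, num g, Submodule.subset_span ⟨g, hg, rfl⟩, hnum g⟩
    | zero => exact ⟨1, S.one_mem, 0, Submodule.zero_mem _, by simp⟩
    | add a b _ _ ha hb =>
      obtain ⟨s, hs, l, hl, e⟩ := ha
      obtain ⟨s', hs', l', hl', e'⟩ := hb
      refine ⟨s * s', S.mul_mem hs hs', s' • l + s • l',
        Submodule.add_mem _ (Submodule.smul_mem _ _ hl) (Submodule.smul_mem _ _ hl'), ?_⟩
      rw [map_add, map_smul, map_smul, ← e, ← e', smul_add, smul_smul, smul_smul, mul_comm s' s]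
    | smul c b _ hb =>
      obtain ⟨s, hs, l, hl, e⟩ := hb
      obtain ⟨⟨a, u⟩, hau⟩ := IsLocalization.surj S c
      refine ⟨u * s, S.mul_mem u.2 hs, a • l, Submodule.smul_mem _ _ hl, ?_⟩
      rw [map_smul, ← e, ← algebraMap_smul AS a, ← hau, ← algebraMap_smul AS (u * s : A),
        ← algebraMap_smul AS s b, smul_smul, smul_smul, map_mul]
      congr 1
      ring
  have hfinal : ∀ m : M, ∃ s ∈ S, ∃ l ∈ Submodule.span A (num '' (G : Set MS)), ∃ m' : M,
      s • m = l + y • m' := by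
    intro m
    obtain ⟨l', hl', v, hv⟩ := hLP (ι m)
    obtain ⟨s, hs, l, hl, e⟩ := hLift l' hl'
    have h1 : ι ((s * den v) • m) = ι (den v • l + y • (s • num v)) := by
      rw [map_add, map_smul, map_smul, map_smul, map_smul, ← e, ← hnum v, hv, smul_add,
        algebraMap_smul]
      simp only [smul_smul]
      congr 2 <;> ring
    obtain ⟨u, hu, h2⟩ := heq _ _ h1
    refine ⟨u * (s * den v), S.mul_mem hu (S.mul_mem hs (hden v)), u • den v • l,
      Submodule.smul_mem _ _ (Submodule.smul_mem _ _ hl), u • s • num v, ?_⟩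
    rw [mul_smul, h2, smul_add, smul_comm u y]
  intro m p hp h
  by_contra hnm
  obtain ⟨s, hs, hex⟩ := hfinal m
  refine hs p ⟨hp, hnm, m, fun a ha => h a ⟨0, Submodule.zero_mem _, 0, by simp [ha]⟩⟩ (h s hex)

/-- dimension one, torsion case -/
lemma kfin_T1 [IsNoetherianRing A] {t : ℕ} (x : Fin t → A) (J : Ideal A) :
    ∀ (M : Type) [AddCommGroup M] [Module A M], (∀ a ∈ J, ∀ m : M, a • m = 0) →
    MTor x M → MDim1 A M → KFin x M 0 → KFin x M 1 → ∀ i, KFin x M i := by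
  induction J using WellFoundedGT.induction with
  | ind J ih =>
  intro M _ _ hJ htor hdim h0 h1 i
  obtain ⟨L, y, hL, hyI, hLy⟩ := loc_main x htor hdim h0
  have hLf : Module.Finite A L := Module.Finite.iff_fg.2 hL
  have hQ0 : KFin x (M ⧸ L) 0 :=
    les_b x L.subtype L.mkQ (Submodule.subtype_injective _) (Submodule.mkQ_surjective _)
      (exact_sub_mkQ L) 0 h0 (kfin_of_finite x 1)
  have hQ1 : KFin x (M ⧸ L) 1 :=
    les_b x L.subtype L.mkQ (Submodule.subtype_injective _) (Submodule.mkQ_surjective _)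
      (exact_sub_mkQ L) 1 h1 (kfin_of_finite x 2)
  refine les_a x L.subtype L.mkQ (Submodule.subtype_injective _) (Submodule.mkQ_surjective _)
      (exact_sub_mkQ L) i (kfin_of_finite x i) ?_
  have hJQ : ∀ a ∈ J, ∀ q : M ⧸ L, a • q = 0 := by
    intro a ha q
    obtain ⟨m, rfl⟩ := Submodule.mkQ_surjective L q
    rw [← map_smul, hJ a ha m, map_zero]
  have htQ : MTor x (M ⧸ L) := htor.of_surj L.mkQ (Submodule.mkQ_surjective _)
  have hdQ : MDim1 A (M ⧸ L) := hdim.of_surj L.mkQ (Submodule.mkQ_surjective _)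
  have hdC : MDim0 A ((M ⧸ L) ⧸ LinearMap.range (LinearMap.lsmul A (M ⧸ L) y)) := by
    intro c p hp hc
    obtain ⟨q, rfl⟩ := Submodule.mkQ_surjective _ c
    obtain ⟨m, rfl⟩ := Submodule.mkQ_surjective L q
    refine hLy m p hp fun a ha => hc a ?_
    obtain ⟨l, hl, m', he⟩ := ha
    have hl0 : L.mkQ l = 0 := (Submodule.Quotient.mk_eq_zero L).2 hl
    rw [← map_smul, ← map_smul, he, map_add, hl0, zero_add]
    refine (Submodule.Quotient.mk_eq_zero _).2 ⟨L.mkQ m', ?_⟩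
    rw [map_smul]
    rfl
  by_cases hyJ : y ∈ J
  · refine kfin_T0 x J _ hJQ htQ ?_ hQ0 i
    refine hdC.of_inj (Submodule.mkQ _) ?_
    rw [← LinearMap.ker_eq_bot, Submodule.ker_mkQ, LinearMap.range_eq_bot]
    refine LinearMap.ext fun q => ?_
    exact hJQ y hyJ q
  · have hK0 : KFin x (LinearMap.ker (LinearMap.lsmul A (M ⧸ L) y)) 0 :=
      les_c0 x (Submodule.subtype _) (Submodule.subtype_injective _) hQ0
    have hR0 : KFin x (LinearMap.range (LinearMap.lsmul A (M ⧸ L) y)) 0 :=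
      les_c0 x (Submodule.subtype _) (Submodule.subtype_injective _) hQ0
    have hK1 : KFin x (LinearMap.ker (LinearMap.lsmul A (M ⧸ L) y)) 1 :=
      les_c x (Submodule.subtype _) (LinearMap.rangeRestrict _) (Submodule.subtype_injective _)
        (LinearMap.surjective_rangeRestrict _) (exact_ker_range _) 0 hR0 hQ1
    have hK : ∀ i, KFin x (LinearMap.ker (LinearMap.lsmul A (M ⧸ L) y)) i := by
      refine ih (J ⊔ Ideal.span {y}) ?_ _ ?_ ?_ ?_ hK0 hK1
      · refine lt_of_le_of_ne le_sup_left fun h => hyJ ?_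
        rw [h]
        exact Ideal.mem_sup_right (Ideal.mem_span_singleton_self y)
      · intro a ha k
        obtain ⟨b, hb, c, hc, rfl⟩ := Submodule.mem_sup.1 ha
        obtain ⟨d, rfl⟩ := Ideal.mem_span_singleton'.1 hc
        have h1 : y • k = 0 := Subtype.ext k.2
        have h2 : b • k = 0 := Subtype.ext (hJQ b hb k.1)
        rw [add_smul, mul_smul, h1, h2, smul_zero, add_zero]
      · exact htQ.of_inj (Submodule.subtype _) (Submodule.subtype_injective _)
      · exact hdQ.of_inj (Submodule.subtype _) (Submodule.subtype_injective _)
    have hR1 : KFin x (LinearMap.range (LinearMap.lsmul A (M ⧸ L) y)) 1 :=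
      les_b x (Submodule.subtype _) (LinearMap.rangeRestrict _) (Submodule.subtype_injective _)
        (LinearMap.surjective_rangeRestrict _) (exact_ker_range _) 1 hQ1 (hK 2)
    have hC0 : KFin x ((M ⧸ L) ⧸ LinearMap.range (LinearMap.lsmul A (M ⧸ L) y)) 0 :=
      les_b x (Submodule.subtype _) (Submodule.mkQ _) (Submodule.subtype_injective _)
        (Submodule.mkQ_surjective _) (exact_sub_mkQ _) 0 hQ0 hR1
    have hC := kfin_T0 x ⊥ _ (by
      intro a ha m
      rw [(Submodule.mem_bot A).1 ha, zero_smul])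
      (htQ.of_surj (Submodule.mkQ _) (Submodule.mkQ_surjective _)) hdC hC0
    cases i with
    | zero => exact hQ0
    | succ i => exact kfin_of_mul x y hyI i (hK (i + 1)) (hC i)


/-- the `y`-power torsion submodule -/
def ytor (y : A) (M : Type) [AddCommGroup M] [Module A M] : Submodule A M where
  carrier := {m | ∃ n : ℕ, y ^ n • m = 0}
  zero_mem' := ⟨0, smul_zero _⟩
  add_mem' := by
    rintro a b ⟨n, hn⟩ ⟨k, hk⟩
    refine ⟨n + k, ?_⟩
    rw [smul_add, pow_add, mul_smul (y ^ n) (y ^ k) b, hk, mul_comm, mul_smul, hn]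
    simp
  smul_mem' := by
    rintro c a ⟨n, hn⟩
    exact ⟨n, by rw [smul_comm, hn, smul_zero]⟩

lemma ytor_quot_inj (y : A) (M : Type) [AddCommGroup M] [Module A M] :
    ∀ q : M ⧸ ytor y M, y • q = 0 → q = 0 := by
  intro q hq
  obtain ⟨m, rfl⟩ := Submodule.mkQ_surjective _ q
  rw [← map_smul] at hq
  obtain ⟨n, hn⟩ := (Submodule.Quotient.mk_eq_zero _).1 hq
  refine (Submodule.Quotient.mk_eq_zero _).2 ⟨n + 1, ?_⟩
  rw [pow_succ, mul_smul, hn]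

lemma pow_inj {y : A} {M : Type} [AddCommGroup M] [Module A M]
    (hinj : ∀ m : M, y • m = 0 → m = 0) (n : ℕ) : ∀ m : M, y ^ n • m = 0 → m = 0 := by
  induction n with
  | zero => intro m h; simpa using h
  | succ n ih =>
    intro m h
    rw [pow_succ, mul_smul] at h
    exact hinj _ (ih _ h)

/-- the multiplicative set of elements `y ^ n * (1 - y * a)` -/
def ySet (y : A) : Submonoid A where
  carrier := {b | ∃ (n : ℕ) (a : A), b = y ^ n * (1 - y * a)}
  one_mem' := ⟨0, 0, by simp⟩
  mul_mem' := by
    rintro _ _ ⟨n, a, rfl⟩ ⟨k, c, rfl⟩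
    exact ⟨n + k, a + c - y * a * c, by ring⟩

/-- annihilator of an element -/
def annEl {M : Type} [AddCommGroup M] [Module A M] (m : M) : Ideal A :=
  LinearMap.ker (LinearMap.toSpanSingleton A M m)

lemma mem_annEl {M : Type} [AddCommGroup M] [Module A M] (m : M) (a : A) :
    a ∈ annEl m ↔ a • m = 0 := by
  simp [annEl]

lemma surj_of_dim0 {y : A} {M : Type} [AddCommGroup M] [Module A M]
    (hinj : ∀ m : M, y • m = 0 → m = 0) (hdim : MDim0 A M) (m : M) : ∃ n : M, y • n = m := by
  by_contra hcon
  have hd : Disjoint ((annEl m : Ideal A) : Set A) (ySet y : Set A) := by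
    rw [Set.disjoint_left]
    rintro _ hb ⟨n, a, rfl⟩
    have hb := (mem_annEl m _).1 hb
    rw [mul_smul] at hb
    have h := pow_inj hinj n _ hb
    rw [sub_smul, one_smul, mul_smul, sub_eq_zero] at h
    exact hcon ⟨a • m, h.symm⟩
  obtain ⟨p, hp, hle, hdis⟩ := Ideal.exists_le_prime_disjoint _ _ hd
  have hmax := hdim m p hp fun a ha => hle ((mem_annEl m a).2 ha)
  have hyp : y ∉ p := fun h => Set.disjoint_left.1 hdis h ⟨1, 0, by simp⟩
  obtain ⟨a, ha⟩ := hmax.exists_inv hyp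
  obtain ⟨i, hi, e⟩ := ha
  refine Set.disjoint_left.1 hdis hi ⟨0, a, ?_⟩
  rw [← e]
  ring

lemma kfin_G0 [IsNoetherianRing A] {t : ℕ} (x : Fin t → A) (k : ℕ) :
    ∀ (M : Type) [AddCommGroup M] [Module A M],
    (∀ (m : M) (j : Fin t), k ≤ j.val → ∃ n : ℕ, x j ^ n • m = 0) →
    MDim0 A M → KFin x M 0 → ∀ i, KFin x M i := by
  induction k with
  | zero =>
    intro M _ _ htor hdim h0
    refine kfin_T0 x ⊥ M ?_ (fun m j => htor m j (Nat.zero_le _)) hdim h0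
    intro a ha m
    rw [(Submodule.mem_bot A).1 ha, zero_smul]
  | succ k ih =>
    intro M _ _ htor hdim h0 i
    by_cases hk : k < t
    · let y := x ⟨k, hk⟩
      have hy : y ∈ Ideal.span (Set.range x) := Ideal.subset_span ⟨_, rfl⟩
      have hM1 : ∀ i, KFin x (ytor y M) i := by
        refine ih _ ?_ (hdim.of_inj (Submodule.subtype _) (Submodule.subtype_injective _))
          (les_c0 x (Submodule.subtype _) (Submodule.subtype_injective _) h0)
        rintro ⟨m, hm⟩ j hj
        rcases Nat.eq_or_lt_of_le hj with h | h
        · obtain ⟨n, hn⟩ := hm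
          have : x j = y := congrArg x (Fin.ext h.symm)
          exact ⟨n, Subtype.ext (by rw [this]; exact hn)⟩
        · obtain ⟨n, hn⟩ := htor m j h
          exact ⟨n, Subtype.ext hn⟩
      refine les_a x (Submodule.subtype (ytor y M)) (Submodule.mkQ _)
        (Submodule.subtype_injective _) (Submodule.mkQ_surjective _) (exact_sub_mkQ _) i (hM1 i) ?_
      exact kfin_of_bij x y hy (ytor_quot_inj y M)
        (surj_of_dim0 (ytor_quot_inj y M)
          (hdim.of_surj (Submodule.mkQ _) (Submodule.mkQ_surjective _))) i
    · refine ih M (fun m j hj => ?_) hdim h0 i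
      have := j.2
      omega

/-- If `y` is injective on `M` of dimension at most one, then `M_y / M` has dimension zero. -/
lemma dim0_loc [IsNoetherianRing A] {y : A} {M : Type} [AddCommGroup M] [Module A M]
    (hinj : ∀ m : M, y • m = 0 → m = 0) (hdim : MDim1 A M) :
    MDim0 A (LocalizedModule (Submonoid.powers y) M ⧸
      LinearMap.range (LocalizedModule.mkLinearMap (Submonoid.powers y) M)) := by
  intro l p hp hl
  obtain ⟨z, rfl⟩ := Submodule.mkQ_surjective _ l
  obtain ⟨⟨m, s⟩, hz⟩ := IsLocalizedModule.surj (Submonoid.powers y)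
    (LocalizedModule.mkLinearMap (Submonoid.powers y) M) z
  obtain ⟨_, n, rfl⟩ := s
  have hz : y ^ n • z = LocalizedModule.mkLinearMap (Submonoid.powers y) M m := hz
  have hyp : y ∈ p := by
    refine hp.mem_of_pow_mem n (hl _ ?_)
    rw [← map_smul, hz]
    exact (Submodule.Quotient.mk_eq_zero _).2 ⟨m, rfl⟩
  have hmp : ∀ a, a • m = 0 → a ∈ p := by
    intro a ha
    apply hl
    have : a • z = 0 := by
      have hu := IsLocalizedModule.map_units
        (LocalizedModule.mkLinearMap (Submonoid.powers y) M) (⟨y ^ n, n, rfl⟩ : Submonoid.powers y)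
      have hi := ((Module.End.isUnit_iff _).1 hu).1
      apply hi
      rw [map_zero]
      change y ^ n • a • z = 0
      rw [smul_comm, hz, ← map_smul, ha, map_zero]
    rw [← map_smul, this, map_zero]
  by_contra hnm
  obtain ⟨r, hr, hpr⟩ := exists_prime_gt_of_not_max p hp hnm
  have hd : Disjoint ((annEl m : Ideal A) : Set A)
      (p.primeCompl ⊔ Submonoid.powers y : Submonoid A) := by
    rw [Set.disjoint_left]
    intro b hb hb2
    obtain ⟨s, hs, _, ⟨k, rfl⟩, rfl⟩ := Submonoid.mem_sup.1 hb2
    have hb := (mem_annEl m _).1 hb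
    have hb : (s * y ^ k) • m = 0 := hb
    rw [mul_comm, mul_smul] at hb
    exact hs (hmp s (pow_inj hinj k _ hb))
  obtain ⟨q, hq, hle, hdis⟩ := Ideal.exists_le_prime_disjoint _ _ hd
  have hqp : q ≤ p := by
    intro a ha
    by_contra hap
    exact Set.disjoint_left.1 hdis ha (Submonoid.mem_sup_left (show a ∈ p.primeCompl from hap))
  have hyq : y ∉ q := fun h => Set.disjoint_left.1 hdis h
    (Submonoid.mem_sup_right (Submonoid.mem_powers y))
  refine hdim m q p r hq hp hr (lt_of_le_of_ne hqp fun e => hyq (e ▸ hyp)) hpr fun a ha => ?_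
  exact hle ((mem_annEl m a).2 ha)

lemma kfin_G1_inj [IsNoetherianRing A] {t : ℕ} (x : Fin t → A) (y : A)
    (hy : y ∈ Ideal.span (Set.range x)) (M : Type) [AddCommGroup M] [Module A M]
    (hinj : ∀ m : M, y • m = 0 → m = 0) (hdim : MDim1 A M) (h1 : KFin x M 1) :
    ∀ i, KFin x M i := by
  let S := Submonoid.powers y
  let ι : M →ₗ[A] LocalizedModule S M := LocalizedModule.mkLinearMap S M
  have hbij : Function.Bijective fun z : LocalizedModule S M => y • z :=
    (Module.End.isUnit_iff _).1 (IsLocalizedModule.map_units ι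
      (⟨y, Submonoid.mem_powers y⟩ : Submonoid.powers y))
  have hN : ∀ i, KFin x (LocalizedModule S M) i := by
    refine kfin_of_bij x y hy (fun m hm => hbij.1 ?_) hbij.2
    change y • m = y • 0
    rw [hm, smul_zero]
  have hι : Function.Injective ι := by
    rw [← LinearMap.ker_eq_bot, LinearMap.ker_eq_bot']
    intro m hm
    obtain ⟨⟨_, n, rfl⟩, hs⟩ := IsLocalizedModule.exists_of_eq (S := S) (f := ι)
      (hm.trans (map_zero ι).symm)
    rw [smul_zero] at hs
    exact pow_inj hinj n m hs
  have hex : Function.Exact ι (LinearMap.range ι).mkQ := LinearMap.exact_map_mkQ_range ι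
  have hL0 : KFin x (LocalizedModule S M ⧸ LinearMap.range ι) 0 :=
    les_b x ι _ hι (Submodule.mkQ_surjective _) hex 0 (hN 0) h1
  have hL := kfin_G0 x t _ (fun m j hj => absurd j.2 (not_lt.2 hj)) (dim0_loc hinj hdim) hL0
  intro i
  cases i with
  | zero => exact kfin_zero_of_inj x y hy hinj
  | succ i => exact les_c x ι _ hι (Submodule.mkQ_surjective _) hex i (hL i) (hN (i + 1))

lemma kfin_G1 [IsNoetherianRing A] {t : ℕ} (x : Fin t → A) (k : ℕ) :
    ∀ (M : Type) [AddCommGroup M] [Module A M],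
    (∀ (m : M) (j : Fin t), k ≤ j.val → ∃ n : ℕ, x j ^ n • m = 0) →
    MDim1 A M → KFin x M 0 → KFin x M 1 → ∀ i, KFin x M i := by
  induction k with
  | zero =>
    intro M _ _ htor hdim h0 h1
    refine kfin_T1 x ⊥ M ?_ (fun m j => htor m j (Nat.zero_le _)) hdim h0 h1
    intro a ha m
    rw [(Submodule.mem_bot A).1 ha, zero_smul]
  | succ k ih =>
    intro M _ _ htor hdim h0 h1 i
    by_cases hk : k < t
    · let y := x ⟨k, hk⟩
      have hy : y ∈ Ideal.span (Set.range x) := Ideal.subset_span ⟨_, rfl⟩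
      have hQ0 : KFin x (M ⧸ ytor y M) 0 := kfin_zero_of_inj x y hy (ytor_quot_inj y M)
      have hM1 : ∀ i, KFin x (ytor y M) i := by
        refine ih _ ?_ (hdim.of_inj (Submodule.subtype _) (Submodule.subtype_injective _))
          (les_c0 x (Submodule.subtype _) (Submodule.subtype_injective _) h0)
          (les_c x (Submodule.subtype (ytor y M)) (Submodule.mkQ _)
            (Submodule.subtype_injective _) (Submodule.mkQ_surjective _) (exact_sub_mkQ _) 0
            hQ0 h1)
        rintro ⟨m, hm⟩ j hj
        rcases Nat.eq_or_lt_of_le hj with h | h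
        · obtain ⟨n, hn⟩ := hm
          have : x j = y := congrArg x (Fin.ext h.symm)
          exact ⟨n, Subtype.ext (by rw [this]; exact hn)⟩
        · obtain ⟨n, hn⟩ := htor m j h
          exact ⟨n, Subtype.ext hn⟩
      have hQ1 : KFin x (M ⧸ ytor y M) 1 :=
        les_b x (Submodule.subtype (ytor y M)) (Submodule.mkQ _)
          (Submodule.subtype_injective _) (Submodule.mkQ_surjective _) (exact_sub_mkQ _) 1
          h1 (hM1 2)
      refine les_a x (Submodule.subtype (ytor y M)) (Submodule.mkQ _)
        (Submodule.subtype_injective _) (Submodule.mkQ_surjective _) (exact_sub_mkQ _) i (hM1 i) ?_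
      exact kfin_G1_inj x y hy _ (ytor_quot_inj y M)
        (hdim.of_surj (Submodule.mkQ _) (Submodule.mkQ_surjective _)) hQ1 i
    · refine ih M (fun m j hj => ?_) hdim h0 h1 i
      have := j.2
      omega

lemma mdim1_of_krullDim (M : Type) [AddCommGroup M] [Module A M]
    (hdim : Order.krullDim ↥(Module.support A M) ≤ 1) : MDim1 A M := by
  intro m p q r hp hq hr hpq hqr hm
  have hmem : ∀ P : PrimeSpectrum A, p ≤ P.asIdeal → P ∈ Module.support A M := by
    intro P hP
    rw [Module.mem_support_iff_exists_annihilator]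
    refine ⟨m, fun a ha => hP (hm a ?_)⟩
    exact (Submodule.mem_annihilator_span_singleton m a).1 ha
  let P : Module.support A M := ⟨⟨p, hp⟩, hmem _ le_rfl⟩
  let Q : Module.support A M := ⟨⟨q, hq⟩, hmem _ hpq.le⟩
  let R : Module.support A M := ⟨⟨r, hr⟩, hmem _ (hpq.le.trans hqr.le)⟩
  have hPQ : P < Q := hpq
  have hQR : Q < R := hqr
  let s : LTSeries (Module.support A M) :=
    { length := 2
      toFun := ![P, Q, R]
      step := by
        intro i
        fin_cases i
        · exact hPQ
        · exact hQR }
  have h := (Order.LTSeries.length_le_krullDim s).trans hdim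
  have h2 : s.length = 2 := rfl
  rw [h2] at h
  exact absurd h (by decide)

/-- If `dim M ≤ 1` and `H^0(x,M)`, `H^1(x,M)` are finitely generated, then `H^i(x,M)`
is finitely generated for all `i ≥ 0`. -/
theorem stmt9 [IsNoetherianRing A] {t : ℕ} (x : Fin t → A)
    (M : Type) [AddCommGroup M] [Module A M]
    (hdim : Order.krullDim ↥(Module.support A M) ≤ 1)
    (h0 : Module.Finite A (KoszulCohomology x M 0))
    (h1 : Module.Finite A (KoszulCohomology x M 1)) :
    ∀ i : ℕ, Module.Finite A (KoszulCohomology x M i) := by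
  intro i
  rw [kfin_iff]
  exact kfin_G1 x t M (fun m j hj => absurd j.2 (not_lt.2 hj)) (mdim1_of_krullDim M hdim)
    ((kfin_iff x M 0).1 h0) ((kfin_iff x M 1).1 h1) i

end
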